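/- arXiv:1104.5380 — 9 statements merged into one kernel-verified Lean document; each statement's English description precedes it below -/
import Mathlib

section
/- Let H be a subgroup of finite index in a group G and let 𝒢 be any group. Let 𝒢^{G/H} denote the group (under pointwise multiplication) of all functions φ : G → 𝒢 satisfying φ(gh) = φ(g) for all g ∈ G and h ∈ H, equipped with the left G-action (g·φ)(x) = φ(g⁻¹x), and form the semidirect product 𝒢^{G/H} ⋊ G. Then there is a bijection between: (i) the set of group homomorphisms H → 𝒢 modulo conjugation by elements of 𝒢, and (ii) the set of group homomorphisms F : G → 𝒢^{G/H} ⋊ G whose composition with the projection 𝒢^{G/H} ⋊ G → G is the identity map of G, modulo conjugation by elements of the subgroup 𝒢^{G/H}. -/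
/-- For a subgroup `H ≤ G` and a group `𝒢`, the group `𝒢^{G/H}` of
`H`-right-invariant functions `G → 𝒢` under pointwise multiplication. -/
def invFns (G 𝒢 : Type*) [Group G] [Group 𝒢] (H : Subgroup G) : Subgroup (G → 𝒢) where
  carrier := {φ | ∀ g : G, ∀ h ∈ H, φ (g * h) = φ g}
  mul_mem' := by
    intro a b ha hb g h hh
    simp only [Pi.mul_apply, ha g h hh, hb g h hh]
  one_mem' := by intro g h hh; rfl
  inv_mem' := by
    intro a ha g h hh
    simp only [Pi.inv_apply, ha g h hh]

/-- The left translation action of `G` on `𝒢^{G/H}`: `(g·φ)(x) = φ(g⁻¹x)`. -/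
def invFnsAct (G 𝒢 : Type*) [Group G] [Group 𝒢] (H : Subgroup G) :
    G →* MulAut ↥(invFns G 𝒢 H) where
  toFun g :=
    { toFun := fun f => ⟨fun x => f.1 (g⁻¹ * x), fun x h hh => by
        simpa [mul_assoc] using f.2 (g⁻¹ * x) h hh⟩
      invFun := fun f => ⟨fun x => f.1 (g * x), fun x h hh => by
        simpa [mul_assoc] using f.2 (g * x) h hh⟩
      left_inv := fun f => by ext x; simp [mul_assoc]
      right_inv := fun f => by ext x; simp [mul_assoc]
      map_mul' := fun f₁ f₂ => rfl }
  map_one' := by ext f x; simp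
  map_mul' := fun g₁ g₂ => by ext f x; simp [mul_assoc]

/-- The conjugation equivalence relation on `Hom(H, 𝒢)` given by conjugation by
elements of `𝒢`. -/
def homConjRel (G 𝒢 : Type*) [Group G] [Group 𝒢] (H : Subgroup G) :
    (↥H →* 𝒢) → (↥H →* 𝒢) → Prop := fun π₁ π₂ =>
  ∃ γ : 𝒢, ∀ h : ↥H, π₂ h = γ * π₁ h * γ⁻¹

/-- The set of homomorphisms `G → 𝒢^{G/H} ⋊ G` whose composition with the projection
to `G` is the identity. -/
def Sections (G 𝒢 : Type*) [Group G] [Group 𝒢] (H : Subgroup G) : Type _ :=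
  {F : G →* (↥(invFns G 𝒢 H) ⋊[invFnsAct G 𝒢 H] G) // ∀ g : G, (F g).right = g}

/-- The relation of conjugacy by elements of the subgroup `𝒢^{G/H}` of the
semidirect product. -/
def sectConjRel (G 𝒢 : Type*) [Group G] [Group 𝒢] (H : Subgroup G) :
    Sections G 𝒢 H → Sections G 𝒢 H → Prop := fun F₁ F₂ =>
  ∃ f : ↥(invFns G 𝒢 H), ∀ g : G,
    F₂.1 g = SemidirectProduct.inl f * F₁.1 g * (SemidirectProduct.inl f)⁻¹

section

variable {G 𝒢 : Type*} [Group G] [Group 𝒢] {H : Subgroup G}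

/-- The cocycle `G → 𝒢^{G/H}` of a section, evaluated at a point of `G`. -/
def Sections.cocycle (F : Sections G 𝒢 H) (g x : G) : 𝒢 := (F.1 g).left.1 x

lemma Sections.cocycle_mul_right (F : Sections G 𝒢 H) (g x : G) {h : G} (hh : h ∈ H) :
    F.cocycle g (x * h) = F.cocycle g x :=
  (F.1 g).left.2 x h hh

lemma Sections.cocycle_eq_one (F : Sections G 𝒢 H) (g : G) {h : G} (hh : h ∈ H) :
    F.cocycle g h = F.cocycle g 1 := by
  simpa using F.cocycle_mul_right g 1 hh

lemma Sections.cocycle_mul (F : Sections G 𝒢 H) (a b x : G) :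
    F.cocycle (a * b) x = F.cocycle a x * F.cocycle b (a⁻¹ * x) := by
  unfold Sections.cocycle
  rw [map_mul, SemidirectProduct.mul_left, F.2 a]
  rfl

lemma sectConjRel_iff (F₁ F₂ : Sections G 𝒢 H) :
    sectConjRel G 𝒢 H F₁ F₂ ↔ ∃ f : ↥(invFns G 𝒢 H), ∀ g x : G,
      F₂.cocycle g x = f.1 x * F₁.cocycle g x * (f.1 (g⁻¹ * x))⁻¹ := by
  refine exists_congr fun f => forall_congr' fun g => ?_
  have key : ∀ x, (SemidirectProduct.inl f * F₁.1 g * (SemidirectProduct.inl f)⁻¹).left.1 x =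
      f.1 x * F₁.cocycle g x * (f.1 (g⁻¹ * x))⁻¹ := by
    intro x
    rw [← map_inv, SemidirectProduct.mul_left, SemidirectProduct.mul_left,
      SemidirectProduct.mul_right, F₁.2 g]
    simp only [SemidirectProduct.left_inl, SemidirectProduct.right_inl, map_one, one_mul]
    rfl
  constructor
  · intro h x
    rw [← key, ← h]
    rfl
  · intro h
    refine SemidirectProduct.ext (Subtype.ext (funext fun x => ?_)) ?_
    · exact (h x).trans (key x).symm
    · simp [F₁.2, F₂.2]

/-- The homomorphism `h ↦ F(h)(1)` on `H` attached to a section `F`. -/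
def Sections.toHom (F : Sections G 𝒢 H) : ↥H →* 𝒢 :=
  MonoidHom.mk' (fun h => F.cocycle h 1) fun a b => by
    rw [Subgroup.coe_mul, F.cocycle_mul, mul_one, F.cocycle_eq_one b (H.inv_mem a.2)]

/-- The chosen representative of the coset `xH`. -/
noncomputable def cosetRep (H : Subgroup G) (x : G) : G := (x : G ⧸ H).out

lemma cosetRep_mul_right (x : G) {h : G} (hh : h ∈ H) : cosetRep H (x * h) = cosetRep H x := by
  unfold cosetRep
  rw [QuotientGroup.mk_mul_of_mem x hh]

/-- The component in `H` of `x`, relative to the chosen representative of `xH`. -/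
noncomputable def cosetPart (H : Subgroup G) (x : G) : ↥H :=
  ⟨(cosetRep H x)⁻¹ * x, QuotientGroup.eq.1 (QuotientGroup.out_eq' (x : G ⧸ H))⟩

lemma coe_cosetPart (x : G) : (cosetPart H x : G) = (cosetRep H x)⁻¹ * x := rfl

lemma cosetPart_mul_right (x : G) (h : ↥H) : cosetPart H (x * h) = cosetPart H x * h := by
  ext
  simp [coe_cosetPart, cosetRep_mul_right x h.2, mul_assoc]

/-- The section induced from a homomorphism on `H`. -/
noncomputable def inducedSection (π : ↥H →* 𝒢) : Sections G 𝒢 H :=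
  ⟨MonoidHom.mk' (fun g => ⟨⟨fun x => π (cosetPart H x * (cosetPart H (g⁻¹ * x))⁻¹), by
      intro x h hh
      have h₁ := cosetPart_mul_right x ⟨h, hh⟩
      have h₂ := cosetPart_mul_right (g⁻¹ * x) ⟨h, hh⟩
      beta_reduce
      rw [← mul_assoc, h₁, h₂]
      congr 1
      group⟩, g⟩) (by
    intro a b
    refine SemidirectProduct.ext (Subtype.ext (funext fun x => ?_)) rfl
    change π _ = π _ * π (cosetPart H (a⁻¹ * x) * (cosetPart H (b⁻¹ * (a⁻¹ * x)))⁻¹)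
    rw [← map_mul, mul_inv_rev, mul_assoc b⁻¹]
    congr 1
    group), fun _ => rfl⟩

lemma inducedSection_cocycle (π : ↥H →* 𝒢) (g x : G) :
    (inducedSection π).cocycle g x = π (cosetPart H x * (cosetPart H (g⁻¹ * x))⁻¹) := rfl

lemma homConjRel_toHom {F₁ F₂ : Sections G 𝒢 H} (h : sectConjRel G 𝒢 H F₁ F₂) :
    homConjRel G 𝒢 H F₁.toHom F₂.toHom := by
  obtain ⟨f, hf⟩ := (sectConjRel_iff F₁ F₂).1 h
  refine ⟨f.1 1, fun h => (hf h 1).trans ?_⟩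
  have := f.2 1 _ (H.inv_mem h.2)
  rw [one_mul] at this
  rw [mul_one, this]
  rfl

lemma sectConjRel_inducedSection {π₁ π₂ : ↥H →* 𝒢} (h : homConjRel G 𝒢 H π₁ π₂) :
    sectConjRel G 𝒢 H (inducedSection π₁) (inducedSection π₂) := by
  obtain ⟨γ, hγ⟩ := h
  exact (sectConjRel_iff _ _).2 ⟨⟨fun _ => γ, fun _ _ _ => rfl⟩, fun _ _ => hγ _⟩

lemma homConjRel_toHom_inducedSection (π : ↥H →* 𝒢) :
    homConjRel G 𝒢 H π (inducedSection π).toHom := by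
  refine ⟨π (cosetPart H 1), fun h => ?_⟩
  change (inducedSection π).cocycle h 1 = _
  have := cosetPart_mul_right 1 h⁻¹
  rw [one_mul, Subgroup.coe_inv] at this
  rw [inducedSection_cocycle, mul_one, this]
  simp [mul_assoc]

lemma sectConjRel_inducedSection_toHom (F : Sections G 𝒢 H) :
    sectConjRel G 𝒢 H F (inducedSection F.toHom) := by
  refine (sectConjRel_iff _ _).2 ⟨⟨fun x => F.cocycle (cosetRep H x)⁻¹ 1, fun x h hh => by
    beta_reduce
    rw [cosetRep_mul_right x hh]⟩, fun g x => ?_⟩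
  rw [inducedSection_cocycle, eq_mul_inv_iff_mul_eq]
  set k := cosetPart H x * (cosetPart H (g⁻¹ * x))⁻¹ with hk
  change F.cocycle k 1 * F.cocycle (cosetRep H (g⁻¹ * x))⁻¹ 1 = F.cocycle (cosetRep H x)⁻¹ 1 * _
  have hx : F.cocycle g x = F.cocycle g (cosetRep H x) := by
    rw [← F.cocycle_mul_right g (cosetRep H x) (cosetPart H x).2, coe_cosetPart,
      mul_inv_cancel_left]
  have hkg : (k : G) * (cosetRep H (g⁻¹ * x))⁻¹ = (cosetRep H x)⁻¹ * g := by
    rw [hk, Subgroup.coe_mul, Subgroup.coe_inv, coe_cosetPart, coe_cosetPart]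
    group
  have hleft := F.cocycle_mul k (cosetRep H (g⁻¹ * x))⁻¹ 1
  rw [mul_one, F.cocycle_eq_one _ (H.inv_mem k.2)] at hleft
  have hright := F.cocycle_mul (cosetRep H x)⁻¹ g 1
  rw [mul_one, inv_inv] at hright
  rw [← hleft, hkg, hright, hx]

end

/-- Frobenius reciprocity for induced representations: for `H ≤ G` of finite index and
an arbitrary group `𝒢`, there is a bijection between homomorphisms `H → 𝒢` modulo
conjugation by `𝒢` and sections `G → 𝒢^{G/H} ⋊ G` modulo conjugation by `𝒢^{G/H}`. -/
theorem stmt_0 (G 𝒢 : Type*) [Group G] [Group 𝒢] (H : Subgroup G) [H.FiniteIndex] :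
    Nonempty (Quot (homConjRel G 𝒢 H) ≃ Quot (sectConjRel G 𝒢 H)) := by
  exact ⟨{
    toFun := Quot.map inducedSection fun _ _ => sectConjRel_inducedSection
    invFun := Quot.map Sections.toHom fun _ _ => homConjRel_toHom
    left_inv := by
      rintro ⟨π⟩
      exact (Quot.sound (homConjRel_toHom_inducedSection π)).symm
    right_inv := by
      rintro ⟨F⟩
      exact (Quot.sound (sectConjRel_inducedSection_toHom F)).symm }⟩
end

section
/- Let V be a finite-dimensional complex vector space with a nondegenerate quadratic form Q, and let G be a group. Suppose π₁, π₂ : G → GL(V) are group homomorphisms such that for each i ∈ {1,2} and each g ∈ G there exists λᵢ(g) ∈ ℂˣ with Q(πᵢ(g)v) = λᵢ(g)·Q(v) for all v ∈ V, and suppose λ₁(g) = λ₂(g) for all g ∈ G. Then there exists A ∈ GL(V) which is a similitude of Q (i.e., there is μ ∈ ℂˣ with Q(Av) = μ·Q(v) for all v ∈ V) and satisfies A·π₁(g)·A⁻¹ = π₂(g) for all g ∈ G, if and only if there exists B ∈ GL(V) with B·π₁(g)·B⁻¹ = π₂(g) for all g ∈ G. -/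
open Polynomial in
/-- A polynomial over an algebraically closed field divides a power of any polynomial vanishing
at all its roots. -/
theorem dvd_pow_card_roots_of_forall_eval_eq_zero {K : Type*} [Field K] [IsAlgClosed K]
    {m f : K[X]} (hm : m.Monic) (hf : ∀ a ∈ m.roots, f.eval a = 0) :
    m ∣ f ^ m.roots.card := by
  have hprod : m = (m.roots.map fun a => X - C a).prod :=
    (IsAlgClosed.splits m).eq_prod_roots_of_monic hm
  have key : ∀ s : Multiset K, (∀ a ∈ s, f.eval a = 0) →
      (s.map fun a => X - C a).prod ∣ f ^ s.card := by
    intro s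
    induction s using Multiset.induction_on with
    | empty => simp
    | cons a s ih =>
      intro hs
      rw [Multiset.map_cons, Multiset.prod_cons, Multiset.card_cons, pow_succ']
      exact mul_dvd_mul (dvd_iff_isRoot.2 (hs a (Multiset.mem_cons_self a s)))
        (ih fun b hb => hs b (Multiset.mem_cons_of_mem hb))
  conv_lhs => rw [hprod]
  exact key _ hf

open Polynomial in
/-- Over an algebraically closed field of characteristic not two, `X` is a square modulo any monic
polynomial that does not vanish at zero. -/
theorem exists_dvd_sq_sub_X {K : Type*} [Field K] [IsAlgClosed K] (h2 : (2 : K) ≠ 0)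
    {m : K[X]} (hm : m.Monic) (h0 : m.coeff 0 ≠ 0) : ∃ p : K[X], m ∣ p ^ 2 - X := by
  classical
  choose r hr using fun a : K => IsAlgClosed.exists_pow_nat_eq a (n := 2) (by norm_num)
  set q : K[X] := Lagrange.interpolate m.roots.toFinset id r
  have hqa : ∀ a ∈ m.roots, (q ^ 2 - X).eval a = 0 := by
    intro a ha
    have : q.eval (id a) = r a :=
      Lagrange.eval_interpolate_at_node r Function.injective_id.injOn (Multiset.mem_toFinset.2 ha)
    simp only [id] at this
    simp [this, hr]
  have hnil : IsNilpotent (AdjoinRoot.mk m (q ^ 2 - X)) :=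
    ⟨m.roots.card, by
      rw [← map_pow, AdjoinRoot.mk_eq_zero]
      exact dvd_pow_card_roots_of_forall_eval_eq_zero hm hqa⟩
  have hX : IsUnit (AdjoinRoot.mk m X) := by
    obtain ⟨a, b, hab⟩ : IsCoprime X m :=
      irreducible_X.coprime_iff_not_dvd.2 fun h => h0 (X_dvd_iff.1 h)
    refine IsUnit.of_mul_eq_one_right (AdjoinRoot.mk m a) ?_
    simpa using congrArg (AdjoinRoot.mk m) hab
  have hunit : IsUnit (AdjoinRoot.mk m q) := by
    have := hnil.isUnit_add_left_of_commute hX (Commute.all _ _)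
    rw [← map_add, add_sub_cancel, map_pow] at this
    exact (isUnit_pow_iff two_ne_zero).1 this
  have h2' : IsUnit (2 : AdjoinRoot m) := by
    have := (IsUnit.mk0 (2 : K) h2).map (algebraMap K (AdjoinRoot m))
    rwa [map_ofNat] at this
  obtain ⟨y, ⟨-, hy⟩, -⟩ := existsUnique_nilpotent_sub_and_aeval_eq_zero
    (P := (X ^ 2 - C (AdjoinRoot.mk m X) : (AdjoinRoot m)[X])) (x := AdjoinRoot.mk m q)
    (by simpa using hnil) (by simpa [one_add_one_eq_two] using h2'.mul hunit)
  obtain ⟨p, rfl⟩ := AdjoinRoot.mk_surjective y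
  refine ⟨p, AdjoinRoot.mk_eq_zero.1 ?_⟩
  simpa using hy

open Polynomial in
/-- An injective endomorphism of a finite-dimensional space over an algebraically closed field of
characteristic not two has a square root which is a polynomial in it. -/
theorem exists_aeval_mul_self_eq {K V : Type*} [Field K] [IsAlgClosed K] (h2 : (2 : K) ≠ 0)
    [AddCommGroup V] [Module K V] [FiniteDimensional K V] (S : Module.End K V)
    (hS : Function.Injective S) : ∃ p : K[X], aeval S p * aeval S p = S := by
  have h0 : (minpoly K S).coeff 0 ≠ 0 := by
    intro h
    have hroot : (minpoly K S).IsRoot 0 := by rwa [IsRoot.def, ← coeff_zero_eq_eval_zero]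
    obtain ⟨v, hv⟩ := (Module.End.hasEigenvalue_of_isRoot hroot).exists_hasEigenvector
    exact hv.2 (hS (by simpa using hv.apply_eq_smul))
  obtain ⟨p, hp⟩ := exists_dvd_sq_sub_X h2 (minpoly.monic (Algebra.IsIntegral.isIntegral S)) h0
  refine ⟨p, ?_⟩
  have := (minpoly.dvd_iff).1 hp
  simpa [sub_eq_zero, sq] using this

open Polynomial in
/-- Polynomials in a self-adjoint endomorphism are self-adjoint. -/
theorem isAdjointPair_aeval {K V : Type*} [CommRing K] [AddCommGroup V] [Module K V]
    (b : LinearMap.BilinForm K V) {S : Module.End K V}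
    (hS : LinearMap.IsAdjointPair b b S S) (p : K[X]) :
    LinearMap.IsAdjointPair b b (aeval S p) (aeval S p) := by
  have hpow : ∀ n : ℕ, LinearMap.IsAdjointPair b b ⇑(S ^ n) ⇑(S ^ n) := by
    intro n
    induction n with
    | zero => exact fun _ _ => rfl
    | succ n ih =>
      intro v w
      rw [pow_succ', Module.End.mul_apply, hS, ih, ← Module.End.mul_apply, ← pow_succ, pow_succ']
  induction p using Polynomial.induction_on' with
  | add p q hp hq =>
    intro v w
    simp only [map_add, LinearMap.add_apply]
    rw [hp, hq]
  | monomial n a =>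
    intro v w
    simp only [aeval_monomial, Module.End.mul_apply, Module.algebraMap_end_apply, map_smul,
      LinearMap.smul_apply]
    rw [hpow]


/-- Two homomorphisms of a group `G` into `GL(V)` landing in the orthogonal similitude
group of a nondegenerate quadratic form `Q` on a finite-dimensional complex space `V`,
with equal similitude factors, are conjugate by a similitude of `Q` if and only if they
are conjugate by an arbitrary invertible linear map. -/
theorem stmt_1 (V : Type*) [AddCommGroup V] [Module ℂ V] [FiniteDimensional ℂ V]
    (Q : QuadraticForm ℂ V)
    (hQ : ∀ v : V, (∀ w : V, QuadraticMap.polar Q v w = 0) → v = 0)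
    (G : Type*) [Group G] (π₁ π₂ : G →* (V ≃ₗ[ℂ] V))
    (lam : G → ℂ) (hlam : ∀ g, lam g ≠ 0)
    (h₁ : ∀ g : G, ∀ v : V, Q (π₁ g v) = lam g * Q v)
    (h₂ : ∀ g : G, ∀ v : V, Q (π₂ g v) = lam g * Q v) :
    (∃ A : V ≃ₗ[ℂ] V, (∃ μ : ℂ, μ ≠ 0 ∧ ∀ v : V, Q (A v) = μ * Q v) ∧
        ∀ g : G, A * π₁ g * A⁻¹ = π₂ g) ↔
      (∃ B : V ≃ₗ[ℂ] V, ∀ g : G, B * π₁ g * B⁻¹ = π₂ g) := by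
  refine ⟨fun ⟨A, _, hA⟩ => ⟨A, hA⟩, fun ⟨B, hB⟩ => ?_⟩
  have hBg : ∀ g v, B (π₁ g v) = π₂ g (B v) := fun g v => by simp [← hB g]
  set b : LinearMap.BilinForm ℂ V := Q.polarBilin with hb
  have hsymm : ∀ v w, b v w = b w v := fun v w => QuadraticMap.polar_comm Q v w
  have hnd : b.Nondegenerate :=
    ⟨hQ, fun v hv => hQ v fun w => (hsymm v w).trans (hv w)⟩
  have hsim : ∀ (π : V ≃ₗ[ℂ] V) (c : ℂ), (∀ v, Q (π v) = c * Q v) →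
      ∀ v w, b (π v) (π w) = c * b v w := by
    intro π c h v w
    simp only [hb, QuadraticMap.polarBilin_apply_apply, QuadraticMap.polar, ← map_add, h]
    ring
  set S : Module.End ℂ V := b.leftAdjointOfNondegenerate hnd B.toLinearMap ∘ₗ B.toLinearMap
  have hS : ∀ v w, b (S v) w = b (B v) (B w) := fun v w =>
    b.isAdjointPairLeftAdjointOfNondegenerate hnd B.toLinearMap (B v) w
  have hSadj : LinearMap.IsAdjointPair b b S S := fun v w => by
    rw [hS, hsymm v, hS, hsymm]
  have hSinj : Function.Injective S := by
    refine (injective_iff_map_eq_zero S).2 fun v hv => ?_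
    refine B.map_eq_zero_iff.1 (hQ _ fun w => ?_)
    have := hS v (B.symm w)
    rw [hv, map_zero, LinearMap.zero_apply, B.apply_symm_apply] at this
    exact this.symm
  have hScomm : ∀ g, Commute S (π₁ g).toLinearMap := by
    intro g
    refine LinearMap.ext fun v => sub_eq_zero.1 (hQ _ fun w => ?_)
    change b (S (π₁ g v) - π₁ g (S v)) w = 0
    obtain ⟨w, rfl⟩ := (π₁ g).surjective w
    rw [map_sub, LinearMap.sub_apply, hS, hBg, hBg, hsim _ _ (h₂ g), hsim _ _ (h₁ g), hS, sub_self]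
  obtain ⟨p, hp⟩ := exists_aeval_mul_self_eq two_ne_zero S hSinj
  set T := Polynomial.aeval S p
  have hTadj : LinearMap.IsAdjointPair b b T T := isAdjointPair_aeval b hSadj p
  have hTcomm : ∀ g, Commute T (π₁ g).toLinearMap := fun g =>
    (Algebra.commute_of_mem_adjoin_singleton_of_commute
      (Polynomial.aeval_mem_adjoin_singleton ℂ S) (hScomm g).symm).symm
  have hTinj : Function.Injective T := by
    refine Function.Injective.of_comp (f := T) ?_
    rwa [← Module.End.coe_mul, hp]
  set e : V ≃ₗ[ℂ] V := LinearEquiv.ofInjectiveEndo T hTinj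
  have heT : ∀ v, e v = T v := fun _ => rfl
  have hπe : ∀ g v, e (π₁ g v) = π₁ g (e v) := fun g v => LinearMap.congr_fun (hTcomm g) v
  refine ⟨B * e⁻¹, ⟨1, one_ne_zero, fun v => ?_⟩, fun g => ?_⟩
  · obtain ⟨v, rfl⟩ := e.surjective v
    have hpolar : ∀ v, b v v = 2 * Q v := fun v => by
      simp [hb, QuadraticMap.polar_self]
    have h := hS v v
    rw [← hp, Module.End.mul_apply, hTadj, hpolar, hpolar] at h
    have hev : (B * e⁻¹) (e v) = B v := congrArg B (e.symm_apply_apply v)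
    rw [hev, one_mul, heT]
    exact (mul_left_cancel₀ two_ne_zero h).symm
  · rw [mul_inv_eq_iff_eq_mul]
    ext v
    obtain ⟨v, rfl⟩ := e.surjective v
    change B (e.symm (π₁ g (e v))) = π₂ g (B (e.symm (e v)))
    rw [← hπe, e.symm_apply_apply, e.symm_apply_apply, hBg]
end

section
/- Every element of GSO(4,ℂ) is of the form X ↦ A·X·Bᵀ for some (A,B) ∈ GL₂(ℂ) × GL₂(ℂ). That is, the homomorphism (A,B) ↦ (X ↦ A·X·Bᵀ) from GL₂(ℂ) × GL₂(ℂ) to GL(M₂(ℂ)) has image exactly the group GSO(4,ℂ) of orthogonal similitudes g of the determinant quadratic form on M₂(ℂ) satisfying λ(g)² = det(g). -/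
open Matrix

/-- A linear endomorphism of `M₂(K)` preserving the determinant and fixing the diagonal matrix
units is, up to conjugation by a diagonal matrix, the identity or the transposition. -/
lemma eq_or_eq_transpose_of_det_eq {K : Type*} [Field K]
    (h : Matrix (Fin 2) (Fin 2) K →ₗ[K] Matrix (Fin 2) (Fin 2) K)
    (hdet : ∀ X, (h X).det = X.det)
    (h₁ : h !![1, 0; 0, 0] = !![1, 0; 0, 0]) (h₂ : h !![0, 0; 0, 1] = !![0, 0; 0, 1]) :
    ∃ D : GL (Fin 2) K, (∀ X, h X = D.1 * X * (D⁻¹).1) ∨ (∀ X, h X = D.1 * Xᵀ * (D⁻¹).1) := by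
  have hX (X : Matrix (Fin 2) (Fin 2) K) : h X = X 0 0 • !![1, 0; 0, 0] +
      X 1 1 • !![0, 0; 0, 1] + X 0 1 • h !![0, 1; 0, 0] + X 1 0 • h !![0, 0; 1, 0] := by
    rw [← h₁, ← h₂]
    simp only [← map_smul, ← map_add]
    congr 1
    ext i j
    fin_cases i <;> fin_cases j <;> simp
  set P := h !![0, 1; 0, 0]
  set Q := h !![0, 0; 1, 0]
  have key (x y z w : K) :
      (x + z * P 0 0 + w * Q 0 0) * (y + z * P 1 1 + w * Q 1 1) -
        (z * P 0 1 + w * Q 0 1) * (z * P 1 0 + w * Q 1 0) = x * y - z * w := by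
    have := hdet !![x, z; w, y]
    rw [hX, det_fin_two, det_fin_two] at this
    simpa using this
  have k₁ := key 0 0 1 0
  have k₂ := key 1 0 1 0
  have k₃ := key 0 1 1 0
  have k₄ := key 0 0 0 1
  have k₅ := key 1 0 0 1
  have k₆ := key 0 1 0 1
  have k₇ := key 0 0 1 1
  have hP₁ : P 1 1 = 0 := by linear_combination k₂ - k₁
  have hP₀ : P 0 0 = 0 := by linear_combination k₃ - k₁
  have hQ₁ : Q 1 1 = 0 := by linear_combination k₅ - k₄
  have hQ₀ : Q 0 0 = 0 := by linear_combination k₆ - k₄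
  simp only [hP₀, hP₁, hQ₀, hQ₁] at k₁ k₄ k₇
  have hP : P 0 1 * P 1 0 = 0 := by linear_combination -k₁
  have hQ : Q 0 1 * Q 1 0 = 0 := by linear_combination -k₄
  have hPQ : P 0 1 * Q 1 0 + Q 0 1 * P 1 0 = 1 := by linear_combination -k₇ - hP - hQ
  have hD (b : K) (hb : b ≠ 0) : ∃ D : GL (Fin 2) K, D.1 = !![b, 0; 0, 1] ∧
      (D⁻¹).1 = !![b⁻¹, 0; 0, 1] :=
    ⟨⟨!![b, 0; 0, 1], !![b⁻¹, 0; 0, 1], by simp [hb, one_fin_two], by simp [hb, one_fin_two]⟩,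
      rfl, rfl⟩
  by_cases hb : P 0 1 = 0
  · have hQP : Q 0 1 * P 1 0 = 1 := by simpa [hb] using hPQ
    have hb' := left_ne_zero_of_mul_eq_one hQP
    have hQ' : Q 1 0 = 0 := (mul_eq_zero.mp hQ).resolve_left hb'
    have hP' : P 1 0 = (Q 0 1)⁻¹ := (inv_eq_of_mul_eq_one_right hQP).symm
    obtain ⟨D, hD₁, hD₂⟩ := hD _ hb'
    refine ⟨D, Or.inr fun X => ?_⟩
    rw [hX, hD₁, hD₂]
    ext i j
    fin_cases i <;> fin_cases j <;>
      simp [Matrix.mul_apply, vecMul, dotProduct, hP₀, hP₁, hQ₀, hQ₁, hb, hQ', hP'] <;>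
      field_simp
  · have hP' : P 1 0 = 0 := (mul_eq_zero.mp hP).resolve_left hb
    have hPQ' : P 0 1 * Q 1 0 = 1 := by simpa [hP'] using hPQ
    have hQ' : Q 1 0 = (P 0 1)⁻¹ := (inv_eq_of_mul_eq_one_right hPQ').symm
    have hQ'' : Q 0 1 = 0 := (mul_eq_zero.mp hQ).resolve_right (by simpa [hQ'] using hb)
    obtain ⟨D, hD₁, hD₂⟩ := hD _ hb
    refine ⟨D, Or.inl fun X => ?_⟩
    rw [hX, hD₁, hD₂]
    ext i j
    fin_cases i <;> fin_cases j <;>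
      simp [Matrix.mul_apply, vecMul, dotProduct, hP₀, hP₁, hQ₀, hQ₁, hP', hQ', hQ''] <;>
      field_simp

/-- A `2 × 2` matrix of trace `1` and determinant `0` is conjugate to the first diagonal matrix
unit. -/
lemma exists_mul_eq_mul_of_trace_eq_one_of_det_eq_zero {K : Type*} [Field K]
    (N : Matrix (Fin 2) (Fin 2) K) (htr : N.trace = 1) (hdet : N.det = 0) :
    ∃ P : GL (Fin 2) K, N * P.1 = P.1 * !![1, 0; 0, 0] := by
  rw [trace_fin_two] at htr
  rw [det_fin_two] at hdet
  have h₁₁ : N 1 1 = 1 - N 0 0 := by linear_combination htr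
  rw [h₁₁] at hdet
  by_cases hp : N 0 0 = 0
  · have hqr : N 0 1 * N 1 0 = 0 := by simpa [hp] using hdet
    refine ⟨GeneralLinearGroup.mkOfDetNeZero !![N 0 1, 1; 1, -N 1 0] ?_, ?_⟩
    · simp [det_fin_two, hqr]
    · ext i j
      fin_cases i <;> fin_cases j <;>
        simp [GeneralLinearGroup.mkOfDetNeZero, Matrix.mul_apply, Fin.sum_univ_two, h₁₁, hp] <;>
        simpa [or_comm] using hqr
  · refine ⟨GeneralLinearGroup.mkOfDetNeZero !![N 0 0, -N 0 1; N 1 0, N 0 0] ?_, ?_⟩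
    · rw [det_fin_two_of]
      intro h
      exact hp (by linear_combination h + hdet)
    · ext i j
      fin_cases i <;> fin_cases j <;>
        simp [GeneralLinearGroup.mkOfDetNeZero, Matrix.mul_apply, Fin.sum_univ_two, h₁₁]
      · linear_combination -hdet
      · ring
      · ring
      · linear_combination hdet

/-- A linear endomorphism of `M₂(K)` scaling the determinant by a nonzero factor is of the form
`X ↦ A * X * Bᵀ` or `X ↦ A * Xᵀ * Bᵀ`. -/
lemma exists_eq_mul_mul_transpose_or {K : Type*} [Field K]
    (g : Matrix (Fin 2) (Fin 2) K →ₗ[K] Matrix (Fin 2) (Fin 2) K) (c : K) (hc : c ≠ 0)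
    (hg : ∀ X, (g X).det = c * X.det) :
    ∃ A B : GL (Fin 2) K, (∀ X, g X = A.1 * X * B.1ᵀ) ∨ (∀ X, g X = A.1 * Xᵀ * B.1ᵀ) := by
  have hM : (g 1).det = c := by simp [hg]
  let M : GL (Fin 2) K := GeneralLinearGroup.mkOfDetNeZero (g 1) (hM ▸ hc)
  have hMg : M.1 = g 1 := rfl
  have hMinv : (M⁻¹).1.det * c = 1 := by
    rw [← hM, ← hMg, ← det_mul, Units.inv_mul, det_one]
  let N := (M⁻¹).1 * g !![1, 0; 0, 0]
  have hN : N.det = 0 := by simp [N, hg]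
  have hN' : (1 - N).det = 0 := by
    have : 1 - N = (M⁻¹).1 * g (1 - !![1, 0; 0, 0]) := by
      rw [map_sub, mul_sub, ← hMg, Units.inv_mul]
    rw [this, det_mul, hg]
    simp [det_fin_two]
  have htr : N.trace = 1 := by
    rw [det_fin_two] at hN hN'
    simp only [Matrix.sub_apply, one_apply_eq, one_apply_ne (zero_ne_one' (Fin 2)),
      one_apply_ne (one_ne_zero' (Fin 2))] at hN'
    rw [trace_fin_two]
    linear_combination hN - hN'
  obtain ⟨P, hP⟩ := exists_mul_eq_mul_of_trace_eq_one_of_det_eq_zero N htr hN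
  let h : Matrix (Fin 2) (Fin 2) K →ₗ[K] Matrix (Fin 2) (Fin 2) K :=
    LinearMap.mulRight K P.1 ∘ₗ LinearMap.mulLeft K ((P⁻¹).1 * (M⁻¹).1) ∘ₗ g
  have hh (X) : h X = (P⁻¹).1 * (M⁻¹).1 * g X * P.1 := rfl
  have hgh (X) : g X = M.1 * P.1 * h X * (P⁻¹).1 := by
    simp only [hh, mul_assoc, Units.mul_inv, mul_one, Units.mul_inv_cancel_left]
  have hPd : (P⁻¹).1.det * P.1.det = 1 := by rw [← det_mul, Units.inv_mul, det_one]
  have hh₀ : h 1 = 1 := by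
    rw [hh, mul_assoc (P⁻¹).1, ← hMg, Units.inv_mul, mul_one, Units.inv_mul]
  have hh₁ : h !![1, 0; 0, 0] = !![1, 0; 0, 0] := by
    rw [hh, mul_assoc (P⁻¹).1, mul_assoc, hP, ← mul_assoc, Units.inv_mul, one_mul]
  have hh₂ : h !![0, 0; 0, 1] = !![0, 0; 0, 1] := by
    have : (!![0, 0; 0, 1] : Matrix (Fin 2) (Fin 2) K) = 1 - !![1, 0; 0, 0] := by
      simp [one_fin_two]
    rw [this, map_sub, hh₀, hh₁]
  obtain ⟨D, hD⟩ := eq_or_eq_transpose_of_det_eq h (fun X => by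
    rw [hh, det_mul, det_mul, det_mul, hg]
    linear_combination X.det * hMinv * ((P⁻¹).1.det * P.1.det) + X.det * hPd) hh₁ hh₂
  let B : GL (Fin 2) K := ⟨((D⁻¹).1 * (P⁻¹).1)ᵀ, (P.1 * D.1)ᵀ, by
    rw [← transpose_mul]; simp [mul_assoc], by
    rw [← transpose_mul]; simp [mul_assoc]⟩
  have hB : B.1ᵀ = (D⁻¹).1 * (P⁻¹).1 := transpose_transpose _
  refine ⟨M * P * D, B, hD.imp ?_ ?_⟩ <;>
  · intro hD X
    rw [hgh, hD, hB]
    simp only [Units.val_mul, mul_assoc]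

/-- The determinant of the endomorphism `X ↦ A * X * Bᵀ` of `Mₙ(K)`. -/
lemma det_mulLeft_comp_mulRight_transpose {K n : Type*} [Field K] [Fintype n] [DecidableEq n]
    (A B : Matrix n n K) :
    LinearMap.det (LinearMap.mulLeft K A ∘ₗ LinearMap.mulRight K Bᵀ) =
      (A.det * B.det) ^ Fintype.card n := by
  rw [← LinearMap.det_toMatrix (stdBasis K n n), mul_pow, ← det_kronecker]
  congr 1
  ext ⟨i, j⟩ ⟨k, l⟩
  have hsingle : (single k l (1 : K) * Bᵀ) = of fun a b => if k = a then B b l else 0 := by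
    ext a b
    by_cases h : k = a
    · subst h; simp
    · simp [h, single_mul_apply_of_ne _ _ _ _ _ (Ne.symm h)]
  rw [LinearMap.toMatrix_apply, stdBasis_eq_single]
  simp [hsingle, stdBasis, Matrix.mul_apply]

/-- The transposition of `M₂(K)` has determinant `-1`. -/
lemma det_transposeLinearEquiv_fin_two {K : Type*} [Field K] :
    LinearMap.det (transposeLinearEquiv (Fin 2) (Fin 2) K K).toLinearMap = -1 := by
  have hM : LinearMap.toMatrix (stdBasis K (Fin 2) (Fin 2)) (stdBasis K (Fin 2) (Fin 2))
      (transposeLinearEquiv (Fin 2) (Fin 2) K K).toLinearMap =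
        Equiv.Perm.permMatrix K (Equiv.prodComm (Fin 2) (Fin 2)) := by
    ext ⟨i, j⟩ ⟨k, l⟩
    fin_cases i <;> fin_cases j <;> fin_cases k <;> fin_cases l <;>
      simp [LinearMap.toMatrix_apply, stdBasis]
  have hsign : Equiv.Perm.sign (Equiv.prodComm (Fin 2) (Fin 2)) = -1 := by decide
  rw [← LinearMap.det_toMatrix (stdBasis K (Fin 2) (Fin 2)), hM, det_permutation, hsign]
  simp

/-- Every element of `GSO(4,ℂ)` — i.e. every invertible linear endomorphism `g` of
`M₂(ℂ)` which is a similitude of the quadratic form `Q(X) = det X` with factor `c`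
satisfying `c² = det g` — is of the form `X ↦ A·X·Bᵀ` with `A, B ∈ GL₂(ℂ)`. -/
theorem stmt_3 (g : Matrix (Fin 2) (Fin 2) ℂ ≃ₗ[ℂ] Matrix (Fin 2) (Fin 2) ℂ)
    (hsim : ∃ c : ℂ, c ≠ 0 ∧ (∀ X : Matrix (Fin 2) (Fin 2) ℂ, (g X).det = c * X.det) ∧
      c ^ 2 = LinearMap.det (g : Matrix (Fin 2) (Fin 2) ℂ →ₗ[ℂ] Matrix (Fin 2) (Fin 2) ℂ)) :
    ∃ A B : GL (Fin 2) ℂ, ∀ X : Matrix (Fin 2) (Fin 2) ℂ,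
      g X = (A : Matrix (Fin 2) (Fin 2) ℂ) * X * (B : Matrix (Fin 2) (Fin 2) ℂ)ᵀ := by
  obtain ⟨c, hc, hg, hdet⟩ := hsim
  obtain ⟨A, B, h | h⟩ := exists_eq_mul_mul_transpose_or g.toLinearMap c hc hg
  · exact ⟨A, B, h⟩
  · exfalso
    have hAB : A.1.det * B.1.det = c := by
      have h₁ := hg 1
      rw [show g 1 = _ from h 1] at h₁
      simpa using h₁
    have hcomp : g.toLinearMap = (LinearMap.mulLeft ℂ A.1 ∘ₗ LinearMap.mulRight ℂ B.1ᵀ) ∘ₗ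
        (transposeLinearEquiv (Fin 2) (Fin 2) ℂ ℂ).toLinearMap :=
      LinearMap.ext fun X => (h X).trans (mul_assoc _ _ _)
    rw [hcomp, LinearMap.det_comp, det_mulLeft_comp_mulRight_transpose,
      det_transposeLinearEquiv_fin_two, hAB, Fintype.card_fin] at hdet
    exact hc (by simpa using (show c ^ 2 = 0 by linear_combination hdet / 2))
end

section
/- Let G be a group, N a subgroup of index 2, and g₀ ∈ G ∖ N. Let ℂˣ carry the G-action in which elements of N act trivially and elements of G ∖ N act by z ↦ z⁻¹. Let φ : N → ℂˣ be a homomorphism satisfying φ(g₀ n g₀⁻¹) = φ(n)⁻¹ for all n ∈ N. Then there exists a crossed homomorphism f : G → ℂˣ (for the twisted action) with f|_N = φ if and only if φ(g₀²) = 1. -/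
open scoped Classical in
/-- The twisted action of `G` on `ℂˣ` attached to an index-2 subgroup `N`:
elements of `N` act trivially and elements of `G ∖ N` act by inversion. -/
noncomputable def twistAct {G : Type*} [Group G] (N : Subgroup G) (g : G) (z : ℂˣ) : ℂˣ :=
  if g ∈ N then z else z⁻¹

/-- Let `N ≤ G` have index 2, `g₀ ∉ N`, and let `φ : N → ℂˣ` be a homomorphism with
`φ(g₀ n g₀⁻¹) = φ(n)⁻¹` for all `n ∈ N`. Then `φ` extends to a crossed homomorphism
`f : G → ℂˣ` for the twisted action if and only if `φ(g₀²) = 1`. -/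
theorem stmt_9 (G : Type*) [Group G] (N : Subgroup G) (hN : N.index = 2)
    (g₀ : G) (hg₀ : g₀ ∉ N) (φ : ↥N →* ℂˣ)
    (hconj : ∀ (n : ↥N) (hc : g₀ * ↑n * g₀⁻¹ ∈ N), φ ⟨g₀ * ↑n * g₀⁻¹, hc⟩ = (φ n)⁻¹)
    (hsq : g₀ ^ 2 ∈ N) :
    (∃ f : G → ℂˣ, (∀ g₁ g₂ : G, f (g₁ * g₂) = f g₁ * twistAct N g₁ (f g₂)) ∧
        ∀ n : ↥N, f ↑n = φ n) ↔
      φ ⟨g₀ ^ 2, hsq⟩ = 1 := by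
  classical
  have mul_mem_iff (a b : G) : a * b ∈ N ↔ (a ∈ N ↔ b ∈ N) :=
    Subgroup.mul_mem_iff_of_index_two hN
  constructor
  · rintro ⟨f, hf, hfφ⟩
    rw [← hfφ, Subgroup.coe_mk, pow_two, hf, twistAct, if_neg hg₀, mul_inv_cancel]
  · intro h1
    have mem_mul_inv {g : G} (hg : g ∉ N) : g * g₀⁻¹ ∈ N := by
      simp [mul_mem_iff, hg, hg₀]
    have conj_mem {n : G} (hn : n ∈ N) : g₀ * n * g₀⁻¹ ∈ N := by
      simp [mul_mem_iff, hn, hg₀]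
    refine ⟨fun g => if hg : g ∈ N then φ ⟨g, hg⟩ else φ ⟨g * g₀⁻¹, mem_mul_inv hg⟩,
      fun a b => ?_, fun n => by simp⟩
    by_cases ha : a ∈ N <;> by_cases hb : b ∈ N <;>
      simp only [twistAct, mul_mem_iff, ha, hb, dite_true, dite_false, if_true, if_false,
        iff_true, iff_false, not_true_eq_false]
    · rw [← map_mul]
      rfl
    · rw [← map_mul]
      congr 1
      ext
      simp [mul_assoc]
    · rw [← hconj ⟨b, hb⟩ (conj_mem hb), ← map_mul]
      congr 1
      ext
      simp [mul_assoc]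
    · rw [← hconj ⟨b * g₀⁻¹, mem_mul_inv hb⟩ (conj_mem (mem_mul_inv hb)), ← mul_one (φ _ * φ _),
        ← h1, ← map_mul, ← map_mul]
      congr 1
      ext
      simp [mul_assoc, pow_two]
end

section
/- Let G be a group, N a subgroup of index 2, s ∈ G ∖ N, and σ the automorphism n ↦ s⁻¹ns of N. Let V = ℂ² and let π : N → GL(V) be a group homomorphism. Define As(π) on V ⊗ V by: As(π)(n)(v ⊗ w) = π(n)v ⊗ π(σ(n))w for n ∈ N, and As(π)(ns) = As(π)(n) ∘ S for n ∈ N, where S(v ⊗ w) = π(s²)w ⊗ v. Then As(π) is a well-defined group homomorphism G → GL(V ⊗ V), and its conjugacy class in GL(V ⊗ V) is independent of the choice of s ∈ G ∖ N. -/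
open scoped TensorProduct

/-- `AsaiProp N s π F` says that the homomorphism `F : G → GL(V ⊗ V)` satisfies the
defining equations of the tensor induction (Asai lift) of `π : N → GL(V)` with respect
to the element `s ∈ G ∖ N`: for `n ∈ N`, `F(n)(v ⊗ w) = π(n)v ⊗ π(s⁻¹ns)w`, and
`F(s)(v ⊗ w) = π(s²)w ⊗ v`. -/
def AsaiProp {G : Type} [Group G] (N : Subgroup G) (s : G)
    (π : ↥N →* ((Fin 2 → ℂ) ≃ₗ[ℂ] (Fin 2 → ℂ)))
    (F : G →* ((TensorProduct ℂ (Fin 2 → ℂ) (Fin 2 → ℂ)) ≃ₗ[ℂ]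
      (TensorProduct ℂ (Fin 2 → ℂ) (Fin 2 → ℂ)))) : Prop :=
  (∀ (n : ↥N) (hc : s⁻¹ * ↑n * s ∈ N) (v w : Fin 2 → ℂ),
      F ↑n (v ⊗ₜ[ℂ] w) = (π n v) ⊗ₜ[ℂ] (π ⟨s⁻¹ * ↑n * s, hc⟩ w))
  ∧ (∀ (h2 : s ^ 2 ∈ N) (v w : Fin 2 → ℂ),
      F s (v ⊗ₜ[ℂ] w) = (π ⟨s ^ 2, h2⟩ w) ⊗ₜ[ℂ] v)

section TensorInduction

variable {G M K V : Type*} [Group G] [Monoid M] [CommRing K] [AddCommGroup V] [Module K V]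
  {N : Subgroup G}

open Classical in
/-- The extension by `1` to all of `G` of a homomorphism defined on a subgroup `N`. -/
noncomputable def extendByOne (π : ↥N →* M) (g : G) : M :=
  if h : g ∈ N then π ⟨g, h⟩ else 1

lemma extendByOne_of_mem (π : ↥N →* M) {g : G} (h : g ∈ N) :
    extendByOne π g = π ⟨g, h⟩ :=
  dif_pos h

lemma extendByOne_mul (π : ↥N →* M) {a b : G} (ha : a ∈ N) (hb : b ∈ N) :
    extendByOne π a * extendByOne π b = extendByOne π (a * b) := by
  rw [extendByOne_of_mem π ha, extendByOne_of_mem π hb, extendByOne_of_mem π (N.mul_mem ha hb),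
    ← map_mul]
  rfl

lemma extendByOne_apply_apply (π : ↥N →* (V ≃ₗ[K] V)) {a b c : G} (ha : a ∈ N) (hb : b ∈ N)
    (hc : a * b = c) (v : V) :
    extendByOne π a (extendByOne π b v) = extendByOne π c v := by
  rw [← hc, ← extendByOne_mul π ha hb, LinearEquiv.mul_apply]

open Classical in
/-- The underlying function of the tensor induction of `π` with respect to `s`. -/
noncomputable def tensorInductionFun (π : ↥N →* (V ≃ₗ[K] V)) (s g : G) :
    (V ⊗[K] V) ≃ₗ[K] (V ⊗[K] V) :=
  if g ∈ N then TensorProduct.congr (extendByOne π g) (extendByOne π (s⁻¹ * g * s))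
  else TensorProduct.comm K V V ≪≫ₗ
    TensorProduct.congr (extendByOne π (g * s)) (extendByOne π (s⁻¹ * g))

lemma tensorInductionFun_tmul_of_mem (π : ↥N →* (V ≃ₗ[K] V)) (s : G) {g : G} (hg : g ∈ N)
    (v w : V) :
    tensorInductionFun π s g (v ⊗ₜ[K] w) =
      extendByOne π g v ⊗ₜ[K] extendByOne π (s⁻¹ * g * s) w := by
  simp [tensorInductionFun, hg]

lemma tensorInductionFun_tmul_of_notMem (π : ↥N →* (V ≃ₗ[K] V)) (s : G) {g : G} (hg : g ∉ N)
    (v w : V) :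
    tensorInductionFun π s g (v ⊗ₜ[K] w) =
      extendByOne π (g * s) w ⊗ₜ[K] extendByOne π (s⁻¹ * g) v := by
  simp [tensorInductionFun, hg]

lemma linearEquiv_ext_tmul {e f : (V ⊗[K] V) ≃ₗ[K] (V ⊗[K] V)}
    (h : ∀ v w : V, e (v ⊗ₜ[K] w) = f (v ⊗ₜ[K] w)) : e = f :=
  LinearEquiv.toLinearMap_injective (TensorProduct.ext' h)

lemma tensorInductionFun_mul (hN : N.index = 2) {s : G} (hs : s ∉ N)
    (π : ↥N →* (V ≃ₗ[K] V)) (a b : G) :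
    tensorInductionFun π s (a * b) = tensorInductionFun π s a * tensorInductionFun π s b := by
  have key : ∀ x y : G, x * y ∈ N ↔ (x ∈ N ↔ y ∈ N) :=
    fun _ _ => Subgroup.mul_mem_iff_of_index_two hN
  refine linearEquiv_ext_tmul fun v w => ?_
  rw [LinearEquiv.mul_apply]
  by_cases ha : a ∈ N <;> by_cases hb : b ∈ N
  · rw [tensorInductionFun_tmul_of_mem π s (by simp [key, ha, hb]),
      tensorInductionFun_tmul_of_mem π s hb, tensorInductionFun_tmul_of_mem π s ha,
      extendByOne_apply_apply π (c := a * b) (by simp [*]) (by simp [*]) (by group),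
      extendByOne_apply_apply π (c := s⁻¹ * (a * b) * s) (by simp [*]) (by simp [*])
        (by group)]
  · rw [tensorInductionFun_tmul_of_notMem π s (by simp [key, ha, hb]),
      tensorInductionFun_tmul_of_notMem π s hb, tensorInductionFun_tmul_of_mem π s ha,
      extendByOne_apply_apply π (c := a * b * s) (by simp [*]) (by simp [*]) (by group),
      extendByOne_apply_apply π (c := s⁻¹ * (a * b)) (by simp [*]) (by simp [*])
        (by group)]
  · rw [tensorInductionFun_tmul_of_notMem π s (by simp [key, ha, hb]),
      tensorInductionFun_tmul_of_mem π s hb, tensorInductionFun_tmul_of_notMem π s ha,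
      extendByOne_apply_apply π (c := a * b * s) (by simp [*]) (by simp [*]) (by group),
      extendByOne_apply_apply π (c := s⁻¹ * (a * b)) (by simp [*]) (by simp [*])
        (by group)]
  · rw [tensorInductionFun_tmul_of_mem π s (by simp [key, ha, hb]),
      tensorInductionFun_tmul_of_notMem π s hb, tensorInductionFun_tmul_of_notMem π s ha,
      extendByOne_apply_apply π (c := a * b) (by simp [*]) (by simp [*]) (by group),
      extendByOne_apply_apply π (c := s⁻¹ * (a * b) * s) (by simp [*]) (by simp [*])
        (by group)]

/-- The tensor induction to `G` of a representation `π` of a subgroup of index `2`, with respect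
to an element `s` outside the subgroup. -/
noncomputable def tensorInduction (hN : N.index = 2) {s : G} (hs : s ∉ N)
    (π : ↥N →* (V ≃ₗ[K] V)) : G →* ((V ⊗[K] V) ≃ₗ[K] (V ⊗[K] V)) :=
  MonoidHom.mk' (tensorInductionFun π s) (tensorInductionFun_mul hN hs π)

/-- Changing `s` to `s'` conjugates the tensor induction by `1 ⊗ π(s'⁻¹s)`. -/
lemma congr_mul_tensorInductionFun (hN : N.index = 2) {s s' : G} (hs : s ∉ N) (hs' : s' ∉ N)
    (π : ↥N →* (V ≃ₗ[K] V)) (g : G) :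
    TensorProduct.congr (1 : V ≃ₗ[K] V) (extendByOne π (s'⁻¹ * s)) * tensorInductionFun π s g =
      tensorInductionFun π s' g *
        TensorProduct.congr (1 : V ≃ₗ[K] V) (extendByOne π (s'⁻¹ * s)) := by
  have key : ∀ x y : G, x * y ∈ N ↔ (x ∈ N ↔ y ∈ N) :=
    fun _ _ => Subgroup.mul_mem_iff_of_index_two hN
  refine linearEquiv_ext_tmul fun v w => ?_
  rw [LinearEquiv.mul_apply, LinearEquiv.mul_apply, TensorProduct.congr_tmul]
  by_cases hg : g ∈ N
  · rw [tensorInductionFun_tmul_of_mem π s hg, tensorInductionFun_tmul_of_mem π s' hg,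
      TensorProduct.congr_tmul,
      extendByOne_apply_apply π (c := s'⁻¹ * g * s) (by simp [*]) (by simp [*])
        (by group),
      extendByOne_apply_apply π (c := s'⁻¹ * g * s) (by simp [*]) (by simp [*])
        (by group)]
    rfl
  · rw [tensorInductionFun_tmul_of_notMem π s hg, tensorInductionFun_tmul_of_notMem π s' hg,
      TensorProduct.congr_tmul,
      extendByOne_apply_apply π (c := s'⁻¹ * g) (by simp [*]) (by simp [*])
        (by group),
      extendByOne_apply_apply π (c := g * s) (by simp [*]) (by simp [*])
        (by group)]
    rfl

end TensorInduction

section AsaiProp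

variable {G : Type} [Group G] {N : Subgroup G} {s : G}
  {π : ↥N →* ((Fin 2 → ℂ) ≃ₗ[ℂ] (Fin 2 → ℂ))}

lemma asaiProp_tensorInduction (hN : N.index = 2) (hs : s ∉ N) :
    AsaiProp N s π (tensorInduction hN hs π) := by
  refine ⟨fun n hc v w => ?_, fun h2 v w => ?_⟩
  · refine (tensorInductionFun_tmul_of_mem π s n.2 v w).trans ?_
    rw [extendByOne_of_mem π n.2, extendByOne_of_mem π hc]
  · refine (tensorInductionFun_tmul_of_notMem π s hs v w).trans ?_
    rw [← pow_two, inv_mul_cancel, extendByOne_of_mem π h2, extendByOne_of_mem π N.one_mem]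
    congr 1
    exact LinearEquiv.congr_fun (map_one π) v

lemma AsaiProp.unique (hN : N.index = 2) (hs : s ∉ N)
    {F F' : G →* (((Fin 2 → ℂ) ⊗[ℂ] (Fin 2 → ℂ)) ≃ₗ[ℂ] ((Fin 2 → ℂ) ⊗[ℂ] (Fin 2 → ℂ)))}
    (hF : AsaiProp N s π F) (hF' : AsaiProp N s π F') : F = F' := by
  have key : ∀ x y : G, x * y ∈ N ↔ (x ∈ N ↔ y ∈ N) :=
    fun _ _ => Subgroup.mul_mem_iff_of_index_two hN
  have h_mem : ∀ n ∈ N, F n = F' n := fun n hn => linearEquiv_ext_tmul fun v w => by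
    have hc : s⁻¹ * n * s ∈ N := by simp [*]
    exact (hF.1 ⟨n, hn⟩ hc v w).trans (hF'.1 ⟨n, hn⟩ hc v w).symm
  have h_s : F s = F' s := linearEquiv_ext_tmul fun v w => by
    have h2 : s ^ 2 ∈ N := by simp [pow_two, key]
    rw [hF.2 h2, hF'.2 h2]
  ext1 g
  by_cases hg : g ∈ N
  · exact h_mem g hg
  · rw [← inv_mul_cancel_right g s, map_mul F, map_mul F', h_s,
      h_mem (g * s⁻¹) (by simp [*])]

end AsaiProp

/-- For `N ≤ G` of index 2, `s ∈ G ∖ N` and a two-dimensional representation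
`π : N → GL(V)` with `V = ℂ²`, the tensor induction `As(π)` is a well-defined group
homomorphism `G → GL(V ⊗ V)`: there exists a unique homomorphism satisfying its
defining equations; moreover its conjugacy class in `GL(V ⊗ V)` does not depend on the
choice of `s ∈ G ∖ N`. -/
theorem stmt_10 (G : Type) [Group G] (N : Subgroup G) (hN : N.index = 2)
    (s : G) (hs : s ∉ N) (π : ↥N →* ((Fin 2 → ℂ) ≃ₗ[ℂ] (Fin 2 → ℂ))) :
    (∃ F, AsaiProp N s π F)
    ∧ (∀ F F', AsaiProp N s π F → AsaiProp N s π F' → F = F')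
    ∧ (∀ s', s' ∉ N → ∀ F F', AsaiProp N s π F → AsaiProp N s' π F' →
        ∃ T : (TensorProduct ℂ (Fin 2 → ℂ) (Fin 2 → ℂ)) ≃ₗ[ℂ]
            (TensorProduct ℂ (Fin 2 → ℂ) (Fin 2 → ℂ)),
          ∀ g : G, F' g = T * F g * T⁻¹) := by
  refine ⟨⟨_, asaiProp_tensorInduction hN hs⟩, fun F F' hF hF' => hF.unique hN hs hF', ?_⟩
  intro s' hs' F F' hF hF'
  obtain rfl := hF.unique hN hs (asaiProp_tensorInduction hN hs)
  obtain rfl := hF'.unique hN hs' (asaiProp_tensorInduction hN hs')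
  exact ⟨_, fun g => eq_mul_inv_of_mul_eq (congr_mul_tensorInductionFun hN hs hs' π g).symm⟩
end

section
/- Let G be a group, N a subgroup of index 2, s ∈ G ∖ N, σ(n) = s⁻¹ns, and V = ℂ². Let π : N → GL(V) be a group homomorphism and χ : N → ℂˣ a homomorphism. Then the tensor induction of the twisted homomorphism π ⊗ χ (defined by n ↦ χ(n)·π(n)) satisfies As(π ⊗ χ)(g) = r(χ)(g)·As(π)(g) for all g ∈ G, where r(χ) : G → ℂˣ is the transfer character of χ. -/
open scoped TensorProduct

/-- Tensor induction of a character twist: if `F` is the Asai lift of `π` and `F'` is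
the Asai lift of the twist `π ⊗ χ` (given by `n ↦ χ(n)·π(n)`), then
`F'(g) = r(χ)(g)·F(g)` for all `g ∈ G`, where `r(χ)` is the transfer character of `χ`:
`r(χ)(n) = χ(n)·χ(s⁻¹ns)` for `n ∈ N` and `r(χ)(g) = χ(g²)` for `g ∉ N`. -/
theorem stmt_12 (G : Type) [Group G] (N : Subgroup G) (hN : N.index = 2)
    (s : G) (hs : s ∉ N)
    (π : ↥N →* ((Fin 2 → ℂ) ≃ₗ[ℂ] (Fin 2 → ℂ))) (χ : ↥N →* ℂˣ)
    (F F' : G →* ((TensorProduct ℂ (Fin 2 → ℂ) (Fin 2 → ℂ)) ≃ₗ[ℂ]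
      (TensorProduct ℂ (Fin 2 → ℂ) (Fin 2 → ℂ))))
    (hF : AsaiProp N s π F)
    (hF' : (∀ (n : ↥N) (hc : s⁻¹ * ↑n * s ∈ N) (v w : Fin 2 → ℂ),
        F' ↑n (v ⊗ₜ[ℂ] w) =
          ((χ n : ℂ) • π n v) ⊗ₜ[ℂ]
            ((χ ⟨s⁻¹ * ↑n * s, hc⟩ : ℂ) • π ⟨s⁻¹ * ↑n * s, hc⟩ w))
      ∧ (∀ (h2 : s ^ 2 ∈ N) (v w : Fin 2 → ℂ),
        F' s (v ⊗ₜ[ℂ] w) = ((χ ⟨s ^ 2, h2⟩ : ℂ) • π ⟨s ^ 2, h2⟩ w) ⊗ₜ[ℂ] v)) :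
    (∀ (g : G) (h : g ∈ N) (hc : s⁻¹ * g * s ∈ N)
        (x : TensorProduct ℂ (Fin 2 → ℂ) (Fin 2 → ℂ)),
      F' g x = ((χ ⟨g, h⟩ * χ ⟨s⁻¹ * g * s, hc⟩ : ℂˣ) : ℂ) • F g x)
    ∧ (∀ (g : G), g ∉ N → ∀ (h2 : g ^ 2 ∈ N)
        (x : TensorProduct ℂ (Fin 2 → ℂ) (Fin 2 → ℂ)),
      F' g x = ((χ ⟨g ^ 2, h2⟩ : ℂˣ) : ℂ) • F g x) := by
  have twist_of_mem : ∀ (g : G) (h : g ∈ N) (hc : s⁻¹ * g * s ∈ N)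
      (x : TensorProduct ℂ (Fin 2 → ℂ) (Fin 2 → ℂ)),
      F' g x = ((χ ⟨g, h⟩ * χ ⟨s⁻¹ * g * s, hc⟩ : ℂˣ) : ℂ) • F g x := by
    intro g h hc x
    induction x with
    | zero => simp
    | add x y hx hy => rw [map_add, map_add, hx, hy, smul_add]
    | tmul v w =>
      rw [hF'.1 ⟨g, h⟩ hc, hF.1 ⟨g, h⟩ hc, TensorProduct.smul_tmul_smul, Units.val_mul]
  have twist_at_s : ∀ (h2 : s ^ 2 ∈ N) (x : TensorProduct ℂ (Fin 2 → ℂ) (Fin 2 → ℂ)),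
      F' s x = (χ ⟨s ^ 2, h2⟩ : ℂ) • F s x := by
    intro h2 x
    induction x with
    | zero => simp
    | add x y hx hy => rw [map_add, map_add, hx, hy, smul_add]
    | tmul v w => rw [hF'.2 h2, hF.2 h2, TensorProduct.smul_tmul']
  refine ⟨twist_of_mem, fun g hg h2 x => ?_⟩
  have hn : g * s⁻¹ ∈ N := by
    rw [Subgroup.mul_mem_iff_of_index_two hN, inv_mem_iff]
    exact iff_of_false hg hs
  have hc : s⁻¹ * (g * s⁻¹) * s ∈ N := by
    simpa using (Subgroup.normal_of_index_eq_two hN).conj_mem _ hn s⁻¹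
  have hs2 : s ^ 2 ∈ N := Subgroup.sq_mem_of_index_two hN s
  have hsq : (⟨g ^ 2, h2⟩ : N) =
      ⟨g * s⁻¹, hn⟩ * ⟨s ^ 2, hs2⟩ * ⟨s⁻¹ * (g * s⁻¹) * s, hc⟩ := by
    ext
    simp [pow_two, mul_assoc]
  have hg_eq : g = g * s⁻¹ * s := by group
  have hF_mul : F g x = F (g * s⁻¹) (F s x) := by
    conv_lhs => rw [hg_eq, map_mul]
    rfl
  have hF'_mul : F' g x = F' (g * s⁻¹) (F' s x) := by
    conv_lhs => rw [hg_eq, map_mul]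
    rfl
  rw [hF_mul, hF'_mul, twist_at_s hs2, map_smul, twist_of_mem _ hn hc, hsq, smul_smul]
  congr 1
  simp only [map_mul, Units.val_mul]
  ring
end

section
/- Let G be a group and let V₁, V₂, W₁, W₂ : G → GL₂(ℂ) be group homomorphisms (two-dimensional complex representations of G). Suppose that the tensor product representations g ↦ V₁(g) ⊗ V₂(g) and g ↦ W₁(g) ⊗ W₂(g) on ℂ² ⊗ ℂ² are conjugate by an element of GL(ℂ² ⊗ ℂ²), and that det(V₁(g))·det(V₂(g)) = det(W₁(g))·det(W₂(g)) for all g ∈ G. Then there exists a homomorphism χ : G → ℂˣ such that either (V₁ is conjugate in GL₂(ℂ) to g ↦ χ(g)·W₁(g) and V₂ is conjugate to g ↦ χ(g)⁻¹·W₂(g)), or (V₂ is conjugate in GL₂(ℂ) to g ↦ χ(g)·W₁(g) and V₁ is conjugate to g ↦ χ(g)⁻¹·W₂(g)). -/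
open Matrix

open scoped Kronecker

open Polynomial in
/-- An invertible complex matrix has a square root which is a polynomial in it. -/
theorem exists_polynomial_aeval_sq_eq {n : Type*} [Fintype n] [DecidableEq n]
    (A : Matrix n n ℂ) (hA : A.det ≠ 0) : ∃ p : ℂ[X], aeval A p * aeval A p = A := by
  set m := A.charpoly with hm
  have hm0 : m ≠ 0 := A.charpoly_monic.ne_zero
  have hprod : (m.roots.map fun a => X - C a).prod = m :=
    prod_multiset_X_sub_C_of_monic_of_roots_card_eq A.charpoly_monic
      (IsAlgClosed.splits m).natDegree_eq_card_roots.symm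
  have hroot0 : ∀ a ∈ m.roots, a ≠ 0 := by
    rintro a ha rfl
    refine hA ?_
    rw [Matrix.det_eq_sign_charpoly_coeff, coeff_zero_eq_eval_zero, (mem_roots hm0).1 ha, mul_zero]
  choose r hr using fun a : ℂ => IsAlgClosed.exists_pow_nat_eq a (n := 2) two_pos
  let q : ℂ[X] := Lagrange.interpolate m.roots.toFinset id r
  have hq : ∀ a ∈ m.roots, q.eval a = r a := fun a ha =>
    Lagrange.eval_interpolate_at_node (v := id) r Function.injective_id.injOn
      (Multiset.mem_toFinset.2 ha)
  have hdvd : m ∣ (q ^ 2 - X) ^ Multiset.card m.roots := by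
    conv_lhs => rw [← hprod]
    rw [← Multiset.prod_replicate, ← Multiset.map_const']
    refine Multiset.prod_dvd_prod_of_dvd _ _ fun a ha => ?_
    rw [dvd_iff_isRoot, IsRoot, eval_sub, eval_pow, eval_X, hq a ha, hr, sub_self]
  have hcop : IsCoprime q m := by
    rw [Polynomial.isCoprime_iff_aeval_ne_zero_of_isAlgClosed (k := ℂ) ℂ]
    intro a
    by_contra! h
    have ha : a ∈ m.roots := (mem_roots hm0).2 (by simpa using h.2)
    have h1 : r a = 0 := by rw [← hq a ha]; simpa using h.1
    have h2 := hr a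
    rw [h1] at h2
    exact hroot0 a ha (by rw [← h2]; simp)
  have hunit : IsUnit (AdjoinRoot.mk m q) := by
    have := hcop.map (AdjoinRoot.mk m)
    rwa [AdjoinRoot.mk_self, isCoprime_zero_right] at this
  obtain ⟨x, ⟨-, hx⟩, -⟩ := existsUnique_nilpotent_sub_and_aeval_eq_zero
    (R := AdjoinRoot m) (x := AdjoinRoot.mk m q) (P := X ^ 2 - C (AdjoinRoot.mk m X))
    ⟨Multiset.card m.roots, by
      have := AdjoinRoot.mk_eq_zero.2 hdvd
      rw [map_pow, map_sub, map_pow] at this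
      simpa using this⟩
    (by
      have h2 : IsUnit (2 : AdjoinRoot m) := by
        rw [← map_ofNat (algebraMap ℂ (AdjoinRoot m)) 2]
        exact (IsUnit.mk0 (2 : ℂ) two_ne_zero).map _
      simpa [one_add_one_eq_two] using h2.mul hunit)
  obtain ⟨p, rfl⟩ := AdjoinRoot.mk_surjective x
  refine ⟨p, ?_⟩
  have h1 : m ∣ p ^ 2 - X := by
    rw [← AdjoinRoot.mk_eq_zero]
    simpa using hx
  obtain ⟨s, hs⟩ := h1
  have := congrArg (aeval A) hs
  rw [map_mul, hm, A.aeval_self_charpoly, zero_mul, map_sub, map_pow, aeval_X, sub_eq_zero,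
    sq] at this
  exact this

open Polynomial in
/-- An intertwining relation passes to polynomials. -/
theorem semiconj_aeval {R A : Type*} [CommSemiring R] [Semiring A] [Algebra R A] {q x y : A}
    (h : SemiconjBy q x y) (p : R[X]) : SemiconjBy q (aeval x p) (aeval y p) := by
  induction p using Polynomial.induction_on' with
  | add p r hp hr => simpa using hp.add_right hr
  | monomial n a =>
    simpa [aeval_monomial] using
      SemiconjBy.mul_right (Algebra.commutes a q).symm (h.pow_right n)

open Polynomial in
theorem transpose_aeval {n : Type*} [Fintype n] [DecidableEq n] (A : Matrix n n ℂ) (p : ℂ[X]) :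
    (aeval A p)ᵀ = aeval Aᵀ p := by
  induction p using Polynomial.induction_on' with
  | add p r hp hr => simp [hp, hr]
  | monomial n a => simp [aeval_monomial, ← Algebra.smul_def]

/-- Two conjugate families of similitudes of a nondegenerate symmetric form, with the same
multipliers, are conjugate by an isometry of the form. -/
theorem exists_isometry_conj {n ι : Type*} [Fintype n] [DecidableEq n]
    (Q T : Matrix n n ℂ) (hQ : IsUnit Q) (hQs : Qᵀ = Q) (hT : IsUnit T)
    (V W : ι → Matrix n n ℂ) (hW : ∀ g, IsUnit (W g)) (μ : ι → ℂ)
    (hV' : ∀ g, (V g)ᵀ * Q * V g = μ g • Q) (hW' : ∀ g, (W g)ᵀ * Q * W g = μ g • Q)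
    (h : ∀ g, V g * T = T * W g) :
    ∃ O : Matrix n n ℂ, Oᵀ * Q * O = Q ∧ ∀ g, V g * O = O * W g := by
  obtain ⟨Q, rfl⟩ := hQ
  set A : Matrix n n ℂ := (Q⁻¹ : (Matrix n n ℂ)ˣ) * (Tᵀ * Q * T) with hAdef
  have hQA : Q * A = Tᵀ * Q * T := by simp [hAdef]
  have hAu : IsUnit A :=
    (Units.isUnit _).mul (((Matrix.isUnit_transpose T).2 hT |>.mul Q.isUnit).mul hT)
  have hAW : ∀ g, Commute (W g) A := by
    intro g
    have e1 : (W g)ᵀ * Q * (W g * A) = (W g)ᵀ * Q * (A * W g) := by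
      calc (W g)ᵀ * Q * (W g * A) = ((W g)ᵀ * Q * W g) * A := by simp only [mul_assoc]
        _ = μ g • (Tᵀ * Q * T) := by rw [hW', smul_mul_assoc, hQA]
        _ = Tᵀ * ((V g)ᵀ * Q * V g) * T := by rw [hV']; simp
        _ = (V g * T)ᵀ * Q * (V g * T) := by simp only [Matrix.transpose_mul, mul_assoc]
        _ = (W g)ᵀ * (Tᵀ * Q * T) * W g := by rw [h]; simp only [Matrix.transpose_mul, mul_assoc]
        _ = (W g)ᵀ * Q * (A * W g) := by rw [← hQA]; simp only [mul_assoc]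
    exact (((Matrix.isUnit_transpose _).2 (hW g)).mul Q.isUnit).mul_left_cancel e1
  obtain ⟨p, hp⟩ := exists_polynomial_aeval_sq_eq A ((Matrix.isUnit_iff_isUnit_det _).1 hAu).ne_zero
  set S := Polynomial.aeval A p with hS
  have hSu : IsUnit S := by
    rw [← hp, ← sq] at hAu
    exact (isUnit_pow_iff two_ne_zero).1 hAu
  have hQS : Q * S = Sᵀ * Q := by
    rw [hS, transpose_aeval]
    refine semiconj_aeval ?_ p
    change Q * A = Aᵀ * Q
    have := congrArg Matrix.transpose hQA
    simp only [Matrix.transpose_mul, Matrix.transpose_transpose, hQs] at this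
    rw [this, hQA, mul_assoc]
  have hWS : ∀ g, Commute (W g) S := fun g => semiconj_aeval (hAW g) p
  obtain ⟨S', hS'⟩ := hSu
  refine ⟨T * (S'⁻¹ : (Matrix n n ℂ)ˣ), ?_, fun g => ?_⟩
  · have e : Sᵀ * ((T * ((S'⁻¹ : (Matrix n n ℂ)ˣ) : Matrix n n ℂ))ᵀ * Q *
        (T * ((S'⁻¹ : (Matrix n n ℂ)ˣ) : Matrix n n ℂ))) = Sᵀ * Q := by
      have h1 : Sᵀ * ((S'⁻¹ : (Matrix n n ℂ)ˣ) : Matrix n n ℂ)ᵀ = 1 := by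
        rw [← Matrix.transpose_mul, ← hS', Units.inv_mul, Matrix.transpose_one]
      calc _ = (Sᵀ * ((S'⁻¹ : (Matrix n n ℂ)ˣ) : Matrix n n ℂ)ᵀ) * (Tᵀ * Q * T) *
            ((S'⁻¹ : (Matrix n n ℂ)ˣ) : Matrix n n ℂ) := by simp only [Matrix.transpose_mul, mul_assoc]
        _ = Q * S * (S * ((S'⁻¹ : (Matrix n n ℂ)ˣ) : Matrix n n ℂ)) := by
          rw [h1, one_mul, ← hQA, ← hp]; simp only [mul_assoc]
        _ = Sᵀ * Q := by rw [hQS, ← hS', Units.mul_inv, mul_one]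
    exact ((Matrix.isUnit_transpose _).2 (hS' ▸ S'.isUnit)).mul_left_cancel e
  · have : Commute (W g) ((S'⁻¹ : (Matrix n n ℂ)ˣ) : Matrix n n ℂ) :=
      Commute.units_inv_right (hS' ▸ hWS g)
    rw [← mul_assoc, h, mul_assoc, this.eq, mul_assoc]

theorem eq_mul_of_det_eq_zero {M : Matrix (Fin 2) (Fin 2) ℂ} (h : M.det = 0) :
    ∃ a b : Fin 2 → ℂ, ∀ i j, M i j = a i * b j := by
  rw [Matrix.det_fin_two] at h
  by_cases h0 : M 0 = 0
  · refine ⟨![0, 1], M 1, fun i j => ?_⟩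
    fin_cases i
    · simp [h0]
    · simp
  by_cases h00 : M 0 0 = 0
  · have h01 : M 0 1 ≠ 0 := fun h1 => h0 (by ext j; fin_cases j <;> assumption)
    refine ⟨fun i => M i 1 / M 0 1, M 0, fun i j => ?_⟩
    have h10 : M 1 0 = 0 := by simpa [h00, h01] using h
    fin_cases i <;> fin_cases j <;> simp [*]
  · refine ⟨fun i => M i 0 / M 0 0, M 0, fun i j => ?_⟩
    fin_cases i <;> fin_cases j <;> simp [*]
    field_simp
    linear_combination h

/-- The polarisation of the determinant form on `2 × 2` matrices. -/
def detPolar (M N : Matrix (Fin 2) (Fin 2) ℂ) : ℂ :=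
  M 0 0 * N 1 1 + M 1 1 * N 0 0 - M 0 1 * N 1 0 - M 1 0 * N 0 1

theorem exists_smul_of_wedge_eq_zero {a c : Fin 2 → ℂ} (ha : a ≠ 0)
    (h : a 0 * c 1 - a 1 * c 0 = 0) : ∃ t : ℂ, c = t • a := by
  by_cases h0 : a 0 = 0
  · have h1 : a 1 ≠ 0 := fun h1 => ha (by ext j; fin_cases j <;> assumption)
    refine ⟨c 1 / a 1, ?_⟩
    have : c 0 = 0 := by simpa [h0, h1] using h
    ext j; fin_cases j <;> simp [*]
  · refine ⟨c 0 / a 0, ?_⟩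
    ext j; fin_cases j <;> simp [*]
    field_simp
    linear_combination h

/-- A basis of `2 × 2` matrices with the same Gram matrix for the determinant form as the matrix
units, and whose first two members have a common left factor, is the image of the matrix units
under a Kronecker product. -/
theorem exists_kronecker_of_common_left {a b d : Fin 2 → ℂ}
    {f : Fin 2 → Fin 2 → Matrix (Fin 2) (Fin 2) ℂ}
    (h00 : ∀ i j, f 0 0 i j = a i * b j) (h01 : ∀ i j, f 0 1 i j = a i * d j)
    (h1010 : detPolar (f 1 0) (f 1 0) = 0)
    (h1111 : detPolar (f 1 1) (f 1 1) = 0) (h0010 : detPolar (f 0 0) (f 1 0) = 0)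
    (h0011 : detPolar (f 0 0) (f 1 1) = 1) (h0110 : detPolar (f 0 1) (f 1 0) = -1)
    (h0111 : detPolar (f 0 1) (f 1 1) = 0) (h1011 : detPolar (f 1 0) (f 1 1) = 0) :
    ∃ A B : Matrix (Fin 2) (Fin 2) ℂ, ∀ k l i j, f k l i j = A i k * B j l := by
  obtain ⟨c, e, h10⟩ := eq_mul_of_det_eq_zero (M := f 1 0) (by
    rw [Matrix.det_fin_two]
    unfold detPolar at h1010
    linear_combination h1010 / 2)
  simp only [detPolar, h00, h01, h10] at h0010 h0011 h0110 h0111 h1011 h1111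
  have hb : b ≠ 0 := by rintro rfl; simp at h0011
  have hac : a 0 * c 1 - a 1 * c 0 ≠ 0 := by
    intro h
    have : (a 0 * c 1 - a 1 * c 0) * (d 0 * e 1 - d 1 * e 0) = -1 := by linear_combination h0110
    simp [h] at this
  obtain ⟨t, rfl⟩ := exists_smul_of_wedge_eq_zero (c := e) hb (by
    have : (a 0 * c 1 - a 1 * c 0) * (b 0 * e 1 - b 1 * e 0) = 0 := by linear_combination h0010
    exact (mul_eq_zero.1 this).resolve_left hac)
  simp only [Pi.smul_apply, smul_eq_mul] at h10 h0010 h0110 h1011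
  generalize hf : f 1 1 = x at *
  have key : (a 0 * c 1 - a 1 * c 0) * t * (d 0 * b 1 - d 1 * b 0) = -1 := by
    linear_combination h0110
  set s := t * (c 0 * d 0 * x 1 1 + c 1 * d 1 * x 0 0 - c 0 * d 1 * x 1 0 - c 1 * d 0 * x 0 1)
    with hs
  have hx : ∀ i j, x i j = t * c i * d j + s * (a i * b j) := by
    intro i j
    fin_cases i <;> fin_cases j <;> simp only [hs, Fin.zero_eta, Fin.mk_one]
    · linear_combination (t * c 0 * d 0) * h0011 - (t * c 0 * b 0) * h0111 - (a 0 * d 0) * h1011 +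
        x 0 0 * key
    · linear_combination (t * c 0 * d 1) * h0011 - (t * c 0 * b 1) * h0111 - (a 0 * d 1) * h1011 +
        x 0 1 * key
    · linear_combination (t * c 1 * d 0) * h0011 - (t * c 1 * b 0) * h0111 - (a 1 * d 0) * h1011 +
        x 1 0 * key
    · linear_combination (t * c 1 * d 1) * h0011 - (t * c 1 * b 1) * h0111 - (a 1 * d 1) * h1011 +
        x 1 1 * key
  have hs0 : s = 0 := by
    clear_value s
    simp only [hx] at h1111 h0011
    linear_combination h1111 / 2 + s * key
  refine ⟨of fun i k => ![a i, t * c i] k, of fun j l => ![b j, d j] l, fun k l i j => ?_⟩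
  fin_cases k <;> fin_cases l <;> simp [h00, h01, h10, hf, hx, hs0]
  ring

/-- The standard alternating form on `ℂ²`. -/
def altForm : Matrix (Fin 2) (Fin 2) ℂ := !![0, 1; -1, 0]

theorem transpose_mul_altForm_mul (M : Matrix (Fin 2) (Fin 2) ℂ) :
    Mᵀ * altForm * M = M.det • altForm := by
  ext i j
  fin_cases i <;> fin_cases j <;>
    simp [altForm, Matrix.mul_apply, Fin.sum_univ_two, Matrix.det_fin_two] <;> ring

theorem transpose_mul_kronecker_altForm_mul (M N : Matrix (Fin 2) (Fin 2) ℂ) :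
    (M ⊗ₖ N)ᵀ * (altForm ⊗ₖ altForm) * (M ⊗ₖ N) = (M.det * N.det) • (altForm ⊗ₖ altForm) := by
  rw [← Matrix.kroneckerMap_transpose, ← Matrix.mul_kronecker_mul, ← Matrix.mul_kronecker_mul,
    transpose_mul_altForm_mul, transpose_mul_altForm_mul, Matrix.smul_kronecker,
    Matrix.kronecker_smul, smul_smul]

theorem isUnit_altForm : IsUnit altForm := by
  rw [Matrix.isUnit_iff_isUnit_det]
  simp [altForm, Matrix.det_fin_two]

theorem transpose_altForm : altFormᵀ = -altForm := by
  ext i j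
  fin_cases i <;> fin_cases j <;> simp [altForm]

/-- Linear determinant preservers on `2 × 2` matrices, in Kronecker form. -/
theorem exists_kronecker_of_isometry {O : Matrix (Fin 2 × Fin 2) (Fin 2 × Fin 2) ℂ}
    (h : Oᵀ * (altForm ⊗ₖ altForm) * O = altForm ⊗ₖ altForm) :
    ∃ A B : Matrix (Fin 2) (Fin 2) ℂ, O = A ⊗ₖ B ∨ O.submatrix id Prod.swap = A ⊗ₖ B := by
  let f : Fin 2 → Fin 2 → Matrix (Fin 2) (Fin 2) ℂ := fun k l => of fun i j => O (i, j) (k, l)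
  have hf : ∀ k l k' l', detPolar (f k l) (f k' l') = altForm k k' * altForm l l' := by
    intro k l k' l'
    rw [← Matrix.kronecker_apply, ← h]
    simp [f, detPolar, altForm, Matrix.mul_apply, Fintype.sum_prod_type, Fin.sum_univ_two]
    ring
  have hft : ∀ k l k' l', detPolar (f k l)ᵀ (f k' l')ᵀ = altForm k k' * altForm l l' := by
    intro k l k' l'
    rw [← hf]
    simp only [detPolar, Matrix.transpose_apply]
    ring
  have hdet : ∀ k l, (f k l).det = 0 := by
    intro k l
    have := hf k l k l
    have h0 : altForm k k = 0 := by fin_cases k <;> simp [altForm]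
    rw [h0, zero_mul] at this
    unfold detPolar at this
    rw [Matrix.det_fin_two]
    linear_combination this / 2
  obtain ⟨a, b, hab⟩ := eq_mul_of_det_eq_zero (hdet 0 0)
  obtain ⟨c, d, hcd⟩ := eq_mul_of_det_eq_zero (hdet 0 1)
  have hne : detPolar (f 0 0) (f 1 1) ≠ 0 := by rw [hf]; simp [altForm]
  have ha : a ≠ 0 := by rintro rfl; exact hne (by simp [detPolar, hab])
  have hb : b ≠ 0 := by rintro rfl; exact hne (by simp [detPolar, hab])
  have horth : (a 0 * c 1 - a 1 * c 0) * (b 0 * d 1 - b 1 * d 0) = 0 := by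
    have := hf 0 0 0 1
    simp only [detPolar, hab, hcd] at this
    simp only [altForm, of_apply, cons_val_zero, cons_val_one, zero_mul] at this
    linear_combination this
  rcases mul_eq_zero.1 horth with h0 | h0
  · obtain ⟨t, rfl⟩ := exists_smul_of_wedge_eq_zero ha h0
    obtain ⟨A, B, hAB⟩ := exists_kronecker_of_common_left (f := f) (d := t • d) hab
      (fun i j => by rw [hcd]; simp only [Pi.smul_apply, smul_eq_mul]; ring)
      (by simp [hf, altForm]) (by simp [hf, altForm]) (by simp [hf, altForm])
      (by simp [hf, altForm]) (by simp [hf, altForm]) (by simp [hf, altForm])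
      (by simp [hf, altForm])
    exact ⟨A, B, Or.inl (by ext ⟨i, j⟩ ⟨k, l⟩; exact hAB k l i j)⟩
  · obtain ⟨t, rfl⟩ := exists_smul_of_wedge_eq_zero hb h0
    obtain ⟨A, B, hAB⟩ := exists_kronecker_of_common_left (f := fun k l => (f k l)ᵀ)
      (a := b) (b := a) (d := t • c)
      (fun i j => by rw [Matrix.transpose_apply, hab, mul_comm])
      (fun i j => by
        rw [Matrix.transpose_apply, hcd]; simp only [Pi.smul_apply, smul_eq_mul]; ring)
      (by simp [hft, altForm]) (by simp [hft, altForm]) (by simp [hft, altForm])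
      (by simp [hft, altForm]) (by simp [hft, altForm]) (by simp [hft, altForm])
      (by simp [hft, altForm])
    refine ⟨B, A, Or.inr ?_⟩
    ext ⟨i, j⟩ ⟨k, l⟩
    rw [Matrix.kronecker_apply, mul_comm]
    exact hAB l k j i

theorem exists_units_smul_of_kronecker_eq {M N M' N' : GL (Fin 2) ℂ}
    (h : (M : Matrix (Fin 2) (Fin 2) ℂ) ⊗ₖ (N : Matrix (Fin 2) (Fin 2) ℂ) =
      (M' : Matrix (Fin 2) (Fin 2) ℂ) ⊗ₖ (N' : Matrix (Fin 2) (Fin 2) ℂ)) :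
    ∃ c : ℂˣ, (M : Matrix (Fin 2) (Fin 2) ℂ) = (c : ℂ) • (M' : Matrix (Fin 2) (Fin 2) ℂ) ∧
      (N : Matrix (Fin 2) (Fin 2) ℂ) =
        ((c⁻¹ : ℂˣ) : ℂ) • (N' : Matrix (Fin 2) (Fin 2) ℂ) := by
  have hentry : ∀ i j k l, M i k * N j l = M' i k * N' j l := fun i j k l => by
    simpa using congrFun (congrFun h (i, j)) (k, l)
  obtain ⟨j, l, hN⟩ : ∃ j l, N j l ≠ 0 := by
    by_contra! h0
    exact N.ne_zero (Matrix.ext h0)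
  have hM : ∀ i k, M i k = N' j l / N j l * M' i k := fun i k => by
    have := hentry i j k l
    field_simp
    linear_combination this
  have hc : N' j l / N j l ≠ 0 := by
    intro h0
    refine M.ne_zero (Matrix.ext fun i k => ?_)
    rw [hM, h0, zero_mul, Matrix.zero_apply]
  obtain ⟨i, k, hM'⟩ : ∃ i k, M' i k ≠ 0 := by
    by_contra! h0
    exact M'.ne_zero (Matrix.ext h0)
  refine ⟨Units.mk0 _ hc, Matrix.ext fun i k => by simpa using hM i k,
    Matrix.ext fun j' l' => ?_⟩
  have := hentry i j' k l'
  rw [hM, mul_right_comm, mul_comm] at this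
  have := mul_left_cancel₀ hM' this
  simp only [Units.val_inv_eq_inv_val, Units.val_mk0, Matrix.smul_apply, smul_eq_mul]
  rw [eq_inv_mul_iff_mul_eq₀ hc, this]

/-- If `V₁ ⊗ V₂` and `W₁ ⊗ W₂` are conjugate by a pure tensor, then the factors are conjugate up
to mutually inverse character twists. -/
theorem exists_character_of_kronecker_conj {G : Type*} [Group G] {V₁ V₂ W₁ W₂ : G →* GL (Fin 2) ℂ}
    {A B : Matrix (Fin 2) (Fin 2) ℂ} (hA : IsUnit A) (hB : IsUnit B)
    (h : ∀ g, ((V₁ g : Matrix (Fin 2) (Fin 2) ℂ) ⊗ₖ (V₂ g : Matrix (Fin 2) (Fin 2) ℂ)) * (A ⊗ₖ B) =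
      (A ⊗ₖ B) * ((W₁ g : Matrix (Fin 2) (Fin 2) ℂ) ⊗ₖ (W₂ g : Matrix (Fin 2) (Fin 2) ℂ))) :
    ∃ χ : G →* ℂˣ,
      (∃ C : GL (Fin 2) ℂ, ∀ g : G,
        (V₁ g : Matrix (Fin 2) (Fin 2) ℂ) =
          (χ g : ℂ) • ((C : Matrix (Fin 2) (Fin 2) ℂ) * (W₁ g : Matrix (Fin 2) (Fin 2) ℂ) *
            (C⁻¹ : GL (Fin 2) ℂ))) ∧
      (∃ C : GL (Fin 2) ℂ, ∀ g : G,
        (V₂ g : Matrix (Fin 2) (Fin 2) ℂ) =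
          (((χ g)⁻¹ : ℂˣ) : ℂ) • ((C : Matrix (Fin 2) (Fin 2) ℂ) *
            (W₂ g : Matrix (Fin 2) (Fin 2) ℂ) * (C⁻¹ : GL (Fin 2) ℂ))) := by
  obtain ⟨A, rfl⟩ := hA
  obtain ⟨B, rfl⟩ := hB
  have hex : ∀ g, ∃ c : ℂˣ,
      ((V₁ g * A : GL (Fin 2) ℂ) : Matrix (Fin 2) (Fin 2) ℂ) =
        (c : ℂ) • ((A * W₁ g : GL (Fin 2) ℂ) : Matrix (Fin 2) (Fin 2) ℂ) ∧
      ((V₂ g * B : GL (Fin 2) ℂ) : Matrix (Fin 2) (Fin 2) ℂ) =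
        ((c⁻¹ : ℂˣ) : ℂ) • ((B * W₂ g : GL (Fin 2) ℂ) : Matrix (Fin 2) (Fin 2) ℂ) := by
    intro g
    refine exists_units_smul_of_kronecker_eq ?_
    simpa only [Units.val_mul, Matrix.mul_kronecker_mul] using h g
  choose c hc₁ hc₂ using hex
  have h₁ : ∀ g, (V₁ g : Matrix (Fin 2) (Fin 2) ℂ) = (c g : ℂ) •
      ((A : Matrix (Fin 2) (Fin 2) ℂ) * (W₁ g : Matrix (Fin 2) (Fin 2) ℂ) *
        (A⁻¹ : GL (Fin 2) ℂ)) := fun g => by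
    rw [← smul_mul_assoc, ← Units.val_mul A, ← hc₁, ← Units.val_mul, mul_inv_cancel_right]
  have h₂ : ∀ g, (V₂ g : Matrix (Fin 2) (Fin 2) ℂ) = (((c g)⁻¹ : ℂˣ) : ℂ) •
      ((B : Matrix (Fin 2) (Fin 2) ℂ) * (W₂ g : Matrix (Fin 2) (Fin 2) ℂ) *
        (B⁻¹ : GL (Fin 2) ℂ)) := fun g => by
    rw [← smul_mul_assoc, ← Units.val_mul B, ← hc₂, ← Units.val_mul, mul_inv_cancel_right]
  have hmul : ∀ g k, c (g * k) = c g * c k := by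
    intro g k
    have e : (c (g * k) : ℂ) • ((A * W₁ (g * k) * A⁻¹ : GL (Fin 2) ℂ) : Matrix (Fin 2) (Fin 2) ℂ) =
        ((c g : ℂ) * c k) •
          ((A * W₁ (g * k) * A⁻¹ : GL (Fin 2) ℂ) : Matrix (Fin 2) (Fin 2) ℂ) := by
      calc _ = (V₁ (g * k) : Matrix (Fin 2) (Fin 2) ℂ) := (h₁ (g * k)).symm
        _ = (V₁ g : Matrix (Fin 2) (Fin 2) ℂ) * (V₁ k : Matrix (Fin 2) (Fin 2) ℂ) := by
          rw [map_mul, Units.val_mul]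
        _ = _ := by
          rw [h₁ g, h₁ k, smul_mul_smul_comm]
          simp only [← Units.val_mul]
          congr 2
          rw [map_mul]
          group
    exact Units.ext (smul_left_injective ℂ (Units.ne_zero _) e)
  exact ⟨MonoidHom.mk' c hmul, ⟨A, h₁⟩, ⟨B, h₂⟩⟩

/-- If two pairs of two-dimensional complex representations of a group `G` have
conjugate tensor products and equal products of determinants, then the pairs are
character twists of each other, possibly after interchanging the two factors. -/
theorem stmt_13 (G : Type*) [Group G]
    (V₁ V₂ W₁ W₂ : G →* GL (Fin 2) ℂ)
    (hconj : ∃ T : GL (Fin 2 × Fin 2) ℂ, ∀ g : G,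
      (V₁ g : Matrix (Fin 2) (Fin 2) ℂ) ⊗ₖ (V₂ g : Matrix (Fin 2) (Fin 2) ℂ) =
        (T : Matrix (Fin 2 × Fin 2) (Fin 2 × Fin 2) ℂ) *
          ((W₁ g : Matrix (Fin 2) (Fin 2) ℂ) ⊗ₖ (W₂ g : Matrix (Fin 2) (Fin 2) ℂ)) *
          (T⁻¹ : GL (Fin 2 × Fin 2) ℂ))
    (hdet : ∀ g : G,
      (V₁ g : Matrix (Fin 2) (Fin 2) ℂ).det * (V₂ g : Matrix (Fin 2) (Fin 2) ℂ).det =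
        (W₁ g : Matrix (Fin 2) (Fin 2) ℂ).det * (W₂ g : Matrix (Fin 2) (Fin 2) ℂ).det) :
    ∃ χ : G →* ℂˣ,
      ((∃ C : GL (Fin 2) ℂ, ∀ g : G,
          (V₁ g : Matrix (Fin 2) (Fin 2) ℂ) =
            (χ g : ℂ) • ((C : Matrix (Fin 2) (Fin 2) ℂ) * (W₁ g : Matrix (Fin 2) (Fin 2) ℂ) *
              (C⁻¹ : GL (Fin 2) ℂ)))
        ∧ (∃ C : GL (Fin 2) ℂ, ∀ g : G,
          (V₂ g : Matrix (Fin 2) (Fin 2) ℂ) =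
            (((χ g)⁻¹ : ℂˣ) : ℂ) • ((C : Matrix (Fin 2) (Fin 2) ℂ) *
              (W₂ g : Matrix (Fin 2) (Fin 2) ℂ) * (C⁻¹ : GL (Fin 2) ℂ)))) ∨
      ((∃ C : GL (Fin 2) ℂ, ∀ g : G,
          (V₂ g : Matrix (Fin 2) (Fin 2) ℂ) =
            (χ g : ℂ) • ((C : Matrix (Fin 2) (Fin 2) ℂ) * (W₁ g : Matrix (Fin 2) (Fin 2) ℂ) *
              (C⁻¹ : GL (Fin 2) ℂ)))
        ∧ (∃ C : GL (Fin 2) ℂ, ∀ g : G,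
          (V₁ g : Matrix (Fin 2) (Fin 2) ℂ) =
            (((χ g)⁻¹ : ℂˣ) : ℂ) • ((C : Matrix (Fin 2) (Fin 2) ℂ) *
              (W₂ g : Matrix (Fin 2) (Fin 2) ℂ) * (C⁻¹ : GL (Fin 2) ℂ)))) := by
  obtain ⟨T, hT⟩ := hconj
  obtain ⟨O, hO, hVO⟩ := exists_isometry_conj (altForm ⊗ₖ altForm)
    (T : Matrix (Fin 2 × Fin 2) (Fin 2 × Fin 2) ℂ) (isUnit_altForm.kronecker isUnit_altForm)
    (by
      rw [← Matrix.kroneckerMap_transpose, transpose_altForm]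
      ext i j
      simp)
    T.isUnit
    (fun g => (V₁ g : Matrix (Fin 2) (Fin 2) ℂ) ⊗ₖ (V₂ g : Matrix (Fin 2) (Fin 2) ℂ))
    (fun g => (W₁ g : Matrix (Fin 2) (Fin 2) ℂ) ⊗ₖ (W₂ g : Matrix (Fin 2) (Fin 2) ℂ))
    (fun g => (W₁ g).isUnit.kronecker (W₂ g).isUnit) _
    (fun g => transpose_mul_kronecker_altForm_mul _ _)
    (fun g => by rw [hdet]; exact transpose_mul_kronecker_altForm_mul _ _)
    (fun g => by rw [hT, mul_assoc, ← Units.val_mul, inv_mul_cancel, Units.val_one, mul_one])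
  have hOu : IsUnit O := by
    have : IsUnit (altForm ⊗ₖ altForm) := isUnit_altForm.kronecker isUnit_altForm
    rw [← hO] at this
    exact isUnit_of_mul_isUnit_right this
  have hunits : ∀ A B : Matrix (Fin 2) (Fin 2) ℂ, IsUnit (A ⊗ₖ B) → IsUnit A ∧ IsUnit B := by
    intro A B hAB
    simpa [Matrix.isUnit_iff_isUnit_det, Matrix.det_kronecker] using hAB
  obtain ⟨A, B, rfl | hAB⟩ := exists_kronecker_of_isometry hO
  · obtain ⟨hA, hB⟩ := hunits A B hOu
    obtain ⟨χ, h⟩ := exists_character_of_kronecker_conj hA hB hVO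
    exact ⟨χ, Or.inl h⟩
  · obtain ⟨hA, hB⟩ := hunits A B (by
      rw [← hAB]
      exact (Matrix.isUnit_submatrix_equiv (e₁ := Equiv.refl _) (e₂ := Equiv.prodComm _ _)).2 hOu)
    have hOBA : ∀ i j k l, O (j, i) (k, l) = B i k * A j l := fun i j k l => by
      rw [mul_comm, ← Matrix.kronecker_apply, ← hAB]
      rfl
    obtain ⟨χ, h₁, h₂⟩ := exists_character_of_kronecker_conj (V₁ := V₂) (V₂ := V₁)
      (W₁ := W₁) (W₂ := W₂) hB hA fun g => by
        ext ⟨i, j⟩ ⟨k, l⟩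
        have := congrFun (congrFun (hVO g) (j, i)) (k, l)
        simp only [Matrix.mul_apply, Fintype.sum_prod_type, Fin.sum_univ_two,
          Matrix.kronecker_apply, hOBA] at this ⊢
        linear_combination this
    exact ⟨χ, Or.inr ⟨h₁, h₂⟩⟩
end

section
/- Let q be a prime power and 𝔽_q the finite field with q elements. Let B ≤ GL₂(𝔽_q) be the subgroup of invertible upper triangular matrices. Let ρ be an irreducible finite-dimensional complex representation of GL₂(𝔽_q) that is trivial on the scalar matrices (ρ(z·I₂) = Id for all z ∈ 𝔽_qˣ) and possesses a nonzero vector fixed by ρ(b) for every b ∈ B. Then either ρ is the trivial one-dimensional representation, or dim ρ = q. -/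
open Matrix

/-- An element of `GL₂(F)` moving `∞` to the given point of the projective line. -/
noncomputable def moveInfty {F : Type*} [Field F] (p : OnePoint F) : GL (Fin 2) F :=
  p.elim 1 fun a ↦ GeneralLinearGroup.mkOfDetNeZero !![a, -1; 1, 0] (by simp)

lemma moveInfty_smul_infty {F : Type*} [Field F] [DecidableEq F] (p : OnePoint F) :
    moveInfty p • (OnePoint.infty : OnePoint F) = p := by
  cases p with
  | infty => simp [moveInfty]
  | coe a => simp [moveInfty, OnePoint.smul_infty_eq_ite, GeneralLinearGroup.mkOfDetNeZero]

section EquivariantFamily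

variable {F V : Type*} [Field F] [AddCommGroup V] [Module ℂ V]
  {ρ : GL (Fin 2) F →* (V ≃ₗ[ℂ] V)}

/-- A vector fixed by the upper triangular matrices extends to an equivariant family of vectors
indexed by the projective line. -/
lemma exists_equivariant_family [DecidableEq F] {v : V}
    (hv : ∀ g : GL (Fin 2) F, (g : Matrix (Fin 2) (Fin 2) F) 1 0 = 0 → ρ g v = v) :
    ∃ x : OnePoint F → V, x OnePoint.infty = v ∧ ∀ g p, ρ g (x p) = x (g • p) := by
  refine ⟨fun p ↦ ρ (moveInfty p) v, by simp [moveInfty], fun g p ↦ ?_⟩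
  have h : ρ ((moveInfty (g • p))⁻¹ * (g * moveInfty p)) v = v := by
    apply hv
    rw [← OnePoint.smul_infty_eq_self_iff, mul_smul, mul_smul, moveInfty_smul_infty,
      inv_smul_eq_iff, moveInfty_smul_infty]
  calc ρ g (ρ (moveInfty p) v) = ρ (g * moveInfty p) v := by rw [map_mul]; rfl
    _ = ρ (moveInfty (g • p) * ((moveInfty (g • p))⁻¹ * (g * moveInfty p))) v := by
      rw [mul_inv_cancel_left]
    _ = ρ (moveInfty (g • p)) v := by
      rw [map_mul, LinearEquiv.mul_apply, h]

lemma eq_infty_of_zero_eq_infty [DecidableEq F] {x : OnePoint F → V}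
    (hx : ∀ g p, ρ g (x p) = x (g • p))
    (h : x ((0 : F) : OnePoint F) = x OnePoint.infty) (p : OnePoint F) :
    x p = x OnePoint.infty := by
  cases p with
  | infty => rfl
  | coe a =>
    let n : GL (Fin 2) F := GeneralLinearGroup.mkOfDetNeZero !![1, a; 0, 1] (by simp)
    have hn₀ : n • ((0 : F) : OnePoint F) = (a : OnePoint F) := by
      simp [n, OnePoint.smul_some_eq_ite, GeneralLinearGroup.mkOfDetNeZero]
    have hn : n • (OnePoint.infty : OnePoint F) = OnePoint.infty := by
      simp [n, OnePoint.smul_infty_eq_ite, GeneralLinearGroup.mkOfDetNeZero]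
    simpa only [hx, hn₀, hn] using congrArg (ρ n) h

variable [Fintype F] [DecidableEq F] {x : OnePoint F → V}

lemma sum_smul_translate (hx : ∀ g p, ρ g (x p) = x (g • p)) {c : F → ℂ}
    (hc : ∑ a, c a • x (a : OnePoint F) = 0) (i : F) :
    ∑ a, c (a + i) • x (a : OnePoint F) = 0 := by
  let n : GL (Fin 2) F := GeneralLinearGroup.mkOfDetNeZero !![1, -i; 0, 1] (by simp)
  have hn (a : F) : n • (a : OnePoint F) = ((a - i : F) : OnePoint F) := by
    simp [n, OnePoint.smul_some_eq_ite, GeneralLinearGroup.mkOfDetNeZero, sub_eq_add_neg]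
  have h := congrArg (ρ n) hc
  simp only [map_sum, map_smul, map_zero, hx, hn] at h
  rw [← h]
  exact Fintype.sum_equiv (Equiv.addRight i) _ _ fun a ↦ by simp

lemma sum_smul_dilate (hx : ∀ g p, ρ g (x p) = x (g • p)) {c : F → ℂ}
    (hc : ∑ a, c a • x (a : OnePoint F) = 0) {t : F} (ht : t ≠ 0) :
    ∑ a, c a • x ((t * a : F) : OnePoint F) = 0 := by
  let d : GL (Fin 2) F := GeneralLinearGroup.mkOfDetNeZero !![t, 0; 0, 1] (by simpa)
  have hd (a : F) : d • (a : OnePoint F) = ((t * a : F) : OnePoint F) := by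
    simp [d, OnePoint.smul_some_eq_ite, GeneralLinearGroup.mkOfDetNeZero]
  have h := congrArg (ρ d) hc
  simpa only [map_sum, map_smul, map_zero, hx, hd] using h

/-- A linear relation between the vectors at the finite points, averaged over dilations, becomes a
relation between the vectors at `0` and `∞`. -/
lemma relation_zero_infty (hx : ∀ g p, ρ g (x p) = x (g • p)) (hsum : ∑ p, x p = 0) {c : F → ℂ}
    (hc : ∑ a, c a • x (a : OnePoint F) = 0) :
    (∑ a, c a - Fintype.card F * c 0) • x ((0 : F) : OnePoint F) +
      (∑ a, c a - c 0) • x OnePoint.infty = 0 := by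
  have hfin : ∑ t : F, x (t : OnePoint F) = -x OnePoint.infty := by
    have h : x OnePoint.infty + ∑ t : F, x (t : OnePoint F) = 0 :=
      (Fintype.sum_option (α := F) x).symm.trans hsum
    exact eq_neg_of_add_eq_zero_right h
  have h₁ : ∑ t : F, ∑ a, c a • x ((t * a : F) : OnePoint F) =
      (∑ a, c a) • x ((0 : F) : OnePoint F) := by
    rw [Finset.sum_eq_single 0 (fun t _ ht ↦ sum_smul_dilate hx hc ht) (by simp)]
    simp [Finset.sum_smul]
  have h₂ : ∑ t : F, ∑ a, c a • x ((t * a : F) : OnePoint F) =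
      (Fintype.card F * c 0) • x ((0 : F) : OnePoint F) -
        (∑ a, c a - c 0) • x OnePoint.infty := by
    rw [Finset.sum_comm, ← Finset.add_sum_erase _ _ (Finset.mem_univ (0 : F)),
      ← Finset.add_sum_erase _ c (Finset.mem_univ (0 : F)), add_sub_cancel_left,
      Finset.sum_smul, sub_eq_add_neg, ← Finset.sum_neg_distrib]
    congr 1
    · simp [mul_smul, Nat.cast_smul_eq_nsmul]
    · refine Finset.sum_congr rfl fun a ha ↦ ?_
      rw [← Finset.smul_sum, ← smul_neg, ← hfin]
      congr 1
      exact Fintype.sum_equiv (Equiv.mulRight₀ a (Finset.ne_of_mem_erase ha)) _ _ fun t ↦ by simp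
  have h := h₁.symm.trans h₂
  rw [sub_smul, h]
  abel

lemma linearIndependent_of_sum_eq_zero (hx : ∀ g p, ρ g (x p) = x (g • p))
    (hsum : ∑ p, x p = 0) (hne : x ((0 : F) : OnePoint F) ≠ x OnePoint.infty) :
    LinearIndependent ℂ fun a : F ↦ x (a : OnePoint F) := by
  rw [Fintype.linearIndependent_iff]
  intro c hc i
  have h := relation_zero_infty hx hsum (sum_smul_translate hx hc i)
  let w : GL (Fin 2) F := GeneralLinearGroup.mkOfDetNeZero !![0, 1; 1, 0] (by simp)
  have hw₀ : w • ((0 : F) : OnePoint F) = OnePoint.infty := by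
    simp [w, OnePoint.smul_some_eq_ite, GeneralLinearGroup.mkOfDetNeZero]
  have hw : w • (OnePoint.infty : OnePoint F) = ((0 : F) : OnePoint F) := by
    simp [w, OnePoint.smul_infty_eq_ite, GeneralLinearGroup.mkOfDetNeZero]
  have h' := congrArg (ρ w) h
  simp only [map_add, map_smul, map_zero, hx, hw₀, hw, zero_add] at h h'
  have key : ((1 - (Fintype.card F : ℂ)) * c i) •
      (x ((0 : F) : OnePoint F) - x OnePoint.infty) = 0 := by
    rw [← sub_eq_zero_of_eq (h.trans h'.symm)]
    module
  have hq : (1 - (Fintype.card F : ℂ)) ≠ 0 := by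
    rw [sub_ne_zero]
    exact_mod_cast (Fintype.one_lt_card (α := F)).ne
  simpa [hq, sub_eq_zero, hne] using key

end EquivariantFamily

/-- An irreducible representation with a nonzero fixed vector is trivial and one-dimensional. -/
lemma trivial_of_fixed_vector {G V : Type*} [Group G] [AddCommGroup V] [Module ℂ V]
    {ρ : G →* (V ≃ₗ[ℂ] V)}
    (hirr : ∀ U : Submodule ℂ V, (∀ g, ∀ v ∈ U, ρ g v ∈ U) → U = ⊥ ∨ U = ⊤)
    {u : V} (hu : u ≠ 0) (hfix : ∀ g, ρ g u = u) :
    Module.finrank ℂ V = 1 ∧ ∀ g v, ρ g v = v := by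
  have hinv : ∀ g, ∀ v ∈ Submodule.span ℂ {u}, ρ g v = v := by
    intro g v hv
    obtain ⟨a, rfl⟩ := Submodule.mem_span_singleton.1 hv
    rw [map_smul, hfix]
  have htop : Submodule.span ℂ {u} = ⊤ :=
    (hirr _ fun g v hv ↦ (hinv g v hv).symm ▸ hv).resolve_left (by simpa using hu)
  refine ⟨?_, fun g v ↦ hinv g v (htop ▸ Submodule.mem_top)⟩
  rw [← finrank_top, ← htop, finrank_span_singleton hu]

/-- The only nontrivial irreducible complex representation of `PGL₂(𝔽_q)` with a
nonzero vector fixed by the Borel subgroup of upper triangular matrices is the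
Steinberg representation, of dimension `q`: an irreducible representation of
`GL₂(𝔽_q)`, trivial on scalars, with a nonzero `B`-fixed vector, is either the trivial
one-dimensional representation or has dimension `q`. -/
theorem stmt_14 (F : Type*) [Field F] [Fintype F]
    (V : Type*) [AddCommGroup V] [Module ℂ V] [FiniteDimensional ℂ V] [Nontrivial V]
    (ρ : GL (Fin 2) F →* (V ≃ₗ[ℂ] V))
    (hirr : ∀ U : Submodule ℂ V, (∀ (g : GL (Fin 2) F), ∀ v ∈ U, ρ g v ∈ U) →
      U = ⊥ ∨ U = ⊤)
    (hscalar : ∀ g : GL (Fin 2) F,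
      (∃ z : F, (g : Matrix (Fin 2) (Fin 2) F) = z • (1 : Matrix (Fin 2) (Fin 2) F)) →
      ∀ v : V, ρ g v = v)
    (hfix : ∃ v : V, v ≠ 0 ∧ ∀ g : GL (Fin 2) F,
      (g : Matrix (Fin 2) (Fin 2) F) 1 0 = 0 → ρ g v = v) :
    (Module.finrank ℂ V = 1 ∧ ∀ (g : GL (Fin 2) F) (v : V), ρ g v = v) ∨
      Module.finrank ℂ V = Fintype.card F := by
  classical
  obtain ⟨v, hv, hvfix⟩ := hfix
  obtain ⟨x, hxv, hx⟩ := exists_equivariant_family hvfix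
  by_cases hsum : ∑ p, x p = 0
  swap
  · refine .inl (trivial_of_fixed_vector hirr hsum fun g ↦ ?_)
    simp only [map_sum, hx]
    exact Equiv.sum_comp (MulAction.toPerm g) x
  by_cases hne : x ((0 : F) : OnePoint F) = x OnePoint.infty
  · refine .inl (trivial_of_fixed_vector hirr hv fun g ↦ ?_)
    rw [← hxv, hx, eq_infty_of_zero_eq_infty hx hne]
  right
  have hli := linearIndependent_of_sum_eq_zero hx hsum hne
  have hmem (p : OnePoint F) :
      x p ∈ Submodule.span ℂ (Set.range fun a : F ↦ x (a : OnePoint F)) := by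
    cases p with
    | coe a => exact Submodule.subset_span ⟨a, rfl⟩
    | infty =>
      have h : x OnePoint.infty + ∑ t : F, x (t : OnePoint F) = 0 :=
        (Fintype.sum_option (α := F) x).symm.trans hsum
      rw [eq_neg_of_add_eq_zero_left h]
      exact neg_mem (sum_mem fun a _ ↦ Submodule.subset_span ⟨a, rfl⟩)
  have htop : Submodule.span ℂ (Set.range fun a : F ↦ x (a : OnePoint F)) = ⊤ := by
    refine (hirr _ fun g u hu ↦ ?_).resolve_left fun hbot ↦ hv ?_
    · induction hu using Submodule.span_induction with
      | mem y hy => obtain ⟨a, rfl⟩ := hy; rw [hx]; exact hmem _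
      | zero => simp
      | add y z _ _ hy hz => rw [map_add]; exact add_mem hy hz
      | smul r y _ hy => rw [map_smul]; exact Submodule.smul_mem _ r hy
    · rw [← hxv, ← Submodule.mem_bot ℂ, ← hbot]
      exact hmem _
  rw [← finrank_top, ← htop, finrank_span_eq_card hli]
end

section
/- Let X be a finite abelian group (written multiplicatively) of order 4, let ε : X → {1, −1} be a function, and let ω, μ ∈ X satisfy ω² = 1, μ ≠ 1, and ε(μχ) = ε(χ) for all χ ∈ X. Assume ε attains both the value 1 and the value −1 on X. Then there exists χ ∈ X with ε(χ) = 1 and ε(ωχ) = 1 if and only if there exists χ ∈ X with ε(χ) = −1 and ε(ωχ) = −1. -/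
/-- Let `p` be a predicate on a group of order 4, invariant under translation by some `μ ≠ 1` and
failing somewhere. If `p` holds at both `a` and `ω * a`, then it fails at both `χ` and `ω * χ` for
some `χ`. -/
theorem exists_not_and_not_mul_of_mul_left_invariant {X : Type*} [Group X] (hX : Nat.card X = 4)
    {p : X → Prop} {ω μ a b : X} (hμ : μ ≠ 1) (hinv : ∀ χ, p (μ * χ) ↔ p χ)
    (ha : p a) (hωa : p (ω * a)) (hb : ¬ p b) : ∃ χ, ¬ p χ ∧ ¬ p (ω * χ) := by
  classical
  by_contra! h
  have : Finite X := Nat.finite_of_card_ne_zero (by omega)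
  have := Fintype.ofFinite X
  have hμb : ¬ p (μ * b) := by rwa [hinv]
  have hne : b ≠ μ * b := by simpa [eq_comm] using hμ
  have hωb := h b hb
  have hωμb := h _ hμb
  have hsep : ∀ {x y}, p x → ¬ p y → x ≠ y := fun hx hy e => hy (e ▸ hx)
  have hcard : ({ω * a, ω * b, ω * (μ * b), b, μ * b} : Finset X).card = 5 := by
    have hω : ∀ {x y}, x ≠ y → ω * x ≠ ω * y := fun hxy => (mul_right_injective ω).ne hxy
    rw [Finset.card_insert_of_notMem, Finset.card_insert_of_notMem,
      Finset.card_insert_of_notMem, Finset.card_pair hne] <;>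
    simp only [Finset.mem_insert, Finset.mem_singleton, not_or]
    · exact ⟨hsep hωμb hb, hsep hωμb hμb⟩
    · exact ⟨hω hne, hsep hωb hb, hsep hωb hμb⟩
    · exact ⟨hω (hsep ha hb), hω (hsep ha hμb), hsep hωa hb, hsep hωa hμb⟩
  have hle := Finset.card_le_univ ({ω * a, ω * b, ω * (μ * b), b, μ * b} : Finset X)
  rw [hcard, ← Nat.card_eq_fintype_card, hX] at hle
  omega

/-- Combinatorial content of Lemma 8.2 on local root numbers: for a finite abelian
group `X` of order 4, a sign function `ε : X → {±1}`, an element `ω` with `ω² = 1`,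
and a nontrivial `μ` with `ε` invariant under translation by `μ`, if `ε` takes both
values `1` and `-1` then `X^{++}` is nonempty iff `X^{--}` is nonempty. -/
theorem stmt_15 (X : Type*) [CommGroup X] (hX : Nat.card X = 4)
    (ε : X → ℤ) (hε : ∀ χ, ε χ = 1 ∨ ε χ = -1)
    (ω μ : X) (hω : ω ^ 2 = 1) (hμ : μ ≠ 1)
    (hinv : ∀ χ, ε (μ * χ) = ε χ)
    (hplus : ∃ χ, ε χ = 1) (hminus : ∃ χ, ε χ = -1) :
    (∃ χ, ε χ = 1 ∧ ε (ω * χ) = 1) ↔ (∃ χ, ε χ = -1 ∧ ε (ω * χ) = -1) := by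
  have hneg : ∀ χ, ε χ ≠ 1 ↔ ε χ = -1 := fun χ => by have := hε χ; omega
  have hpos : ∀ χ, ε χ ≠ -1 ↔ ε χ = 1 := fun χ => by have := hε χ; omega
  obtain ⟨a, ha⟩ := hplus
  obtain ⟨b, hb⟩ := hminus
  constructor
  · rintro ⟨χ, h₁, h₂⟩
    simpa only [← hneg] using exists_not_and_not_mul_of_mul_left_invariant hX
      (p := fun χ => ε χ = 1) hμ (fun χ => by rw [hinv]) h₁ h₂ ((hneg b).2 hb)
  · rintro ⟨χ, h₁, h₂⟩
    simpa only [← hpos] using exists_not_and_not_mul_of_mul_left_invariant hX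
      (p := fun χ => ε χ = -1) hμ (fun χ => by rw [hinv]) h₁ h₂ ((hpos a).2 ha)
end
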